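/- Beresnevich's Khintchine-type theorem for approximation by algebraic numbers: Let n be a positive integer and let Ψ : ℕ → ℝ_{>0} be a non-increasing function. Let 𝒜ₙ(Ψ) be the set of real numbers ξ such that the inequality |ξ − α| < H(α)^{−n} · Ψ(H(α)) has infinitely many solutions in real algebraic numbers α of degree exactly n. Then 𝒜ₙ(Ψ) has full Lebesgue measure (its complement has Lebesgue measure zero) if the series Σ_{h≥1} Ψ(h) diverges, and 𝒜ₙ(Ψ) has Lebesgue measure zero if this series converges. -/

import Mathlib

open MeasureTheory

/-- The (usual) height of an integer polynomial: the maximum of the absolute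
values of its coefficients. -/
noncomputable def intPolyHeight (f : Polynomial ℤ) : ℕ :=
  (Finset.range (f.natDegree + 1)).sup fun i => (f.coeff i).natAbs

/-- `P` is the minimal polynomial over `ℤ` of the real algebraic number `α`:
a primitive integer polynomial with positive leading coefficient, vanishing at
`α`, of minimal degree among nonzero integer polynomials vanishing at `α`. -/
def IsMinIntPoly (α : ℝ) (P : Polynomial ℤ) : Prop :=
  P ≠ 0 ∧ 0 < P.leadingCoeff ∧ P.content = 1 ∧ Polynomial.aeval α P = 0 ∧
    ∀ Q : Polynomial ℤ, Q ≠ 0 → Polynomial.aeval α Q = 0 → P.natDegree ≤ Q.natDegree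

/-- A subset of `ℝ` of measure larger than `2 * d * τ` contains `d + 1` points that are
`τ`-separated. -/
lemma exists_separated_finset {E : Set ℝ} {τ : ℝ} (hτ : 0 < τ) (d : ℕ)
    (hE : ENNReal.ofReal (2 * d * τ) < volume E) :
    ∃ s : Finset ℝ, s.card = d + 1 ∧ (s : Set ℝ) ⊆ E ∧
      (s : Set ℝ).Pairwise fun x y => τ ≤ |x - y| := by
  induction d with
  | zero =>
    have : E.Nonempty := nonempty_of_measure_ne_zero (bot_lt_iff_ne_bot.1 (by simpa using hE))
    obtain ⟨x, hx⟩ := this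
    exact ⟨{x}, by simp, by simpa using hx, by simp⟩
  | succ d ih =>
    obtain ⟨s, hs, hsE, hsep⟩ := ih (lt_of_le_of_lt (by gcongr; simp) hE)
    have hU : volume (⋃ z ∈ s, Metric.ball z τ) ≤ ENNReal.ofReal (2 * (d + 1 : ℕ) * τ) := by
      refine (measure_biUnion_finset_le _ _).trans ?_
      simp only [Real.volume_ball, Finset.sum_const, hs, nsmul_eq_mul]
      rw [← ENNReal.ofReal_natCast, ← ENNReal.ofReal_mul (by positivity)]
      apply le_of_eq
      congr 1
      ring
    have : ¬ E ⊆ ⋃ z ∈ s, Metric.ball z τ := fun h =>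
      absurd ((measure_mono h).trans hU) (not_le.2 hE)
    obtain ⟨x, hxE, hx⟩ := Set.not_subset.1 this
    simp only [Set.mem_iUnion, Metric.mem_ball, not_exists, not_lt, Real.dist_eq] at hx
    have hxs : x ∉ s := fun h => by
      have := hx x h
      simp at this
      linarith
    refine ⟨insert x s, by rw [Finset.card_insert_of_notMem hxs, hs], ?_, ?_⟩
    · rw [Finset.coe_insert]
      exact Set.insert_subset hxE hsE
    · rw [Finset.coe_insert]
      refine hsep.insert fun y hy _ => ⟨hx y hy, ?_⟩
      rw [abs_sub_comm]
      exact hx y hy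

/-- Polynomials of bounded degree are rarely much smaller than their maximum on an interval. -/
lemma exists_volume_polynomial_small_le (d : ℕ) {η : ℝ} (hη : 0 < η) :
    ∃ ε : ℝ, 0 < ε ∧ ε ≤ 1 ∧ ∀ p : Polynomial ℝ, p.natDegree ≤ d → ∀ x r : ℝ, 0 < r →
      (∃ y ∈ Metric.closedBall x r, 1 ≤ |p.eval y|) →
      volume {z ∈ Metric.closedBall x r | |p.eval z| < ε} ≤ ENNReal.ofReal (η * r) := by
  set c : ℝ := (d + 1) * (4 * (d + 1) / η) ^ d with hc
  have hcpos : 0 < c := by positivity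
  refine ⟨min 1 (1 / (2 * c)), by positivity, min_le_left _ _, ?_⟩
  rintro p hp x r hr ⟨y, hy, hpy⟩
  by_contra! hlt
  set ε := min 1 (1 / (2 * c)) with hε
  have hεpos : 0 < ε := by positivity
  have hεc : ε * c < 1 := by
    have : ε ≤ 1 / (2 * c) := min_le_right _ _
    calc ε * c ≤ 1 / (2 * c) * c := by gcongr
      _ = 1 / 2 := by field_simp
      _ < 1 := by norm_num
  set τ := η * r / (2 * (d + 1)) with hτ
  have hτpos : 0 < τ := by positivity
  obtain ⟨s, hs, hsE, hsep⟩ := exists_separated_finset hτpos d (E := _) (by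
    refine lt_of_le_of_lt (ENNReal.ofReal_le_ofReal ?_) hlt
    rw [hτ]
    have : (d : ℝ) / (d + 1) ≤ 1 := by
      rw [div_le_one (by positivity)]; linarith
    calc 2 * d * (η * r / (2 * (d + 1))) = (d / (d + 1)) * (η * r) := by field_simp
      _ ≤ 1 * (η * r) := by gcongr
      _ = η * r := one_mul _)
  have hdeg : p.degree < s.card := by
    rw [hs]
    refine lt_of_le_of_lt p.degree_le_natDegree ?_
    exact_mod_cast Nat.lt_succ_of_le hp
  have hInt := Lagrange.eq_interpolate (s := s) (v := id) (Function.injective_id.injOn) hdeg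
  have hle : |p.eval y| ≤ ε * c := by
    rw [hInt, Lagrange.interpolate_apply, Polynomial.eval_finsetSum]
    refine (Finset.abs_sum_le_sum_abs _ _).trans ?_
    have hterm : ∀ i ∈ s, |Polynomial.eval y (Polynomial.C (Polynomial.eval (id i) p) *
        Lagrange.basis s id i)| ≤ ε * (4 * (d + 1) / η) ^ d := by
      intro i hi
      rw [Polynomial.eval_mul, Polynomial.eval_C, abs_mul]
      have hi' := hsE hi
      have h1 : |Polynomial.eval (id i) p| ≤ ε := hi'.2.le
      refine mul_le_mul h1 ?_ (abs_nonneg _) hεpos.le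
      rw [Lagrange.basis, Polynomial.eval_prod, Finset.abs_prod]
      have hcard : (s.erase i).card = d := by rw [Finset.card_erase_of_mem hi, hs]; simp
      calc ∏ j ∈ s.erase i, |Polynomial.eval y (Lagrange.basisDivisor (id i) (id j))|
          ≤ ∏ j ∈ s.erase i, (4 * (d + 1) / η) := by
            refine Finset.prod_le_prod (fun _ _ => abs_nonneg _) fun j hj => ?_
            have hj' := hsE (Finset.mem_of_mem_erase hj)
            simp only [Lagrange.basisDivisor, Polynomial.eval_mul, Polynomial.eval_C,
              Polynomial.eval_sub, Polynomial.eval_X, abs_mul, abs_inv, id]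
            have hij : τ ≤ |i - j| :=
              hsep hi (Finset.mem_of_mem_erase hj) (Finset.ne_of_mem_erase hj).symm
            have hyj : |y - j| ≤ 2 * r := by
              have a := hj'.1
              rw [Metric.mem_closedBall, Real.dist_eq, abs_le] at a hy
              rw [abs_le]
              constructor <;> linarith [a.1, a.2, hy.1, hy.2]
            calc |i - j|⁻¹ * |y - j| ≤ τ⁻¹ * (2 * r) := by gcongr
              _ = 4 * (d + 1) / η := by rw [hτ]; field_simp; ring
        _ = _ := by rw [Finset.prod_const, hcard]
    refine (Finset.sum_le_sum hterm).trans (le_of_eq ?_)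
    rw [Finset.sum_const, hs, hc, nsmul_eq_mul]
    push_cast
    ring
  linarith

/-- A point `x` is marked for a finite poset `P` of polynomials if some chain `S` of `P` consists of
polynomials of absolute value at most `1` at `x`, while all members of `P` comparable to the whole
of `S` have absolute value at least `ε` at `x`. -/
def IsMarked {α : Type*} [PartialOrder α] (P : Finset α) (f : α → Polynomial ℝ) (ε x : ℝ) : Prop :=
  ∃ S ⊆ P, IsChain (· ≤ ·) (S : Set α) ∧ (∀ W ∈ S, |(f W).eval x| ≤ 1) ∧
    ∀ W ∈ P, (∀ U ∈ S, U ≤ W ∨ W ≤ U) → ε ≤ |(f W).eval x|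

lemma IsMarked.of_comparable {α : Type*} [PartialOrder α] [DecidableEq α] {P P' : Finset α}
    {f : α → Polynomial ℝ} {ε x : ℝ} {Γ : α} (hΓ : Γ ∈ P)
    (hP' : ∀ W, W ∈ P' ↔ W ∈ P ∧ W ≠ Γ ∧ (W ≤ Γ ∨ Γ ≤ W)) (h : IsMarked P' f ε x)
    (hle : |(f Γ).eval x| ≤ 1) (hge : ε ≤ |(f Γ).eval x|) : IsMarked P f ε x := by
  obtain ⟨S, hSP, hS, hS1, hSε⟩ := h
  refine ⟨insert Γ S, ?_, ?_, ?_, ?_⟩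
  · exact Finset.insert_subset hΓ fun W hW => ((hP' W).1 (hSP hW)).1
  · rw [Finset.coe_insert]
    exact hS.insert fun W hW _ => ((hP' W).1 (hSP hW)).2.2.symm
  · intro W hW
    rcases Finset.mem_insert.1 hW with rfl | hW
    · exact hle
    · exact hS1 W hW
  · intro W hW hcomp
    by_cases hWΓ : W = Γ
    · rwa [hWΓ]
    · refine hSε W ((hP' W).2 ⟨hW, hWΓ, ?_⟩) fun U hU => hcomp U (Finset.mem_insert_of_mem hU)
      exact (hcomp Γ (Finset.mem_insert_self _ _)).symm

/-- The first radius at which a function with a point of absolute value at least `1` reaches such a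
point. -/
lemma infDist_one_le_abs_spec (p : Polynomial ℝ) (x : ℝ) (hne : {y | 1 ≤ |p.eval y|}.Nonempty) :
    (∃ y ∈ Metric.closedBall x (Metric.infDist x {y | 1 ≤ |p.eval y|}), 1 ≤ |p.eval y|) ∧
    (|p.eval x| < 1 → 0 < Metric.infDist x {y | 1 ≤ |p.eval y|}) ∧
    (0 < Metric.infDist x {y | 1 ≤ |p.eval y|} →
      ∀ z ∈ Metric.closedBall x (Metric.infDist x {y | 1 ≤ |p.eval y|}), |p.eval z| ≤ 1) := by
  set Y : Set ℝ := {y | 1 ≤ |p.eval y|} with hY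
  have hcl : IsClosed Y := isClosed_le continuous_const p.continuous.abs
  refine ⟨?_, ?_, ?_⟩
  · obtain ⟨y, hy, hxy⟩ := hcl.exists_infDist_eq_dist hne x
    refine ⟨y, ?_, hy⟩
    rw [Metric.mem_closedBall, dist_comm, hxy]
  · intro hx
    refine (hcl.notMem_iff_infDist_pos hne).1 ?_
    simpa [hY] using hx
  · intro hpos z hz
    rw [← closure_ball x hpos.ne'] at hz
    have hcl' : IsClosed {z | |p.eval z| ≤ 1} := isClosed_le p.continuous.abs continuous_const
    refine (hcl'.closure_subset_iff.2 ?_) hz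
    intro w hw
    by_contra hcon
    have hwY : w ∈ Y := by
      simp only [hY, Set.mem_ofPred_eq, not_le] at hcon ⊢
      exact hcon.le
    have := Metric.infDist_le_dist_of_mem (x := x) hwY
    rw [Metric.mem_ball, dist_comm] at hw
    linarith

/-- Quantitative nondivergence for finite posets of polynomials. -/
lemma exists_volume_not_isMarked_le (k d : ℕ) : ∀ {η : ℝ}, 0 < η →
    ∃ ε : ℝ, 0 < ε ∧ ε ≤ 1 ∧ ∀ {α : Type} [PartialOrder α] (P : Finset α) (f : α → Polynomial ℝ),
      (∀ W ∈ P, (f W).natDegree ≤ d) →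
      (∀ S ⊆ P, IsChain (· ≤ ·) (S : Set α) → S.card ≤ k) →
      ∀ x r : ℝ, 0 < r → (∀ W ∈ P, ∃ y ∈ Metric.closedBall x r, 1 ≤ |(f W).eval y|) →
      volume {z ∈ Metric.closedBall x r | ¬ IsMarked P f ε z} ≤ ENNReal.ofReal (η * r) := by
  classical
  induction k with
  | zero =>
    intro η hη
    refine ⟨1, one_pos, le_rfl, ?_⟩
    intro α _ P f _ hch x r hr _
    have hP : P = ∅ := by
      by_contra hne
      obtain ⟨W, hW⟩ := Finset.nonempty_iff_ne_empty.2 hne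
      have := hch {W} (by simpa using hW) (by simp)
      simp at this
    have : {z ∈ Metric.closedBall x r | ¬ IsMarked P f 1 z} = ∅ := by
      ext z
      simp only [Set.mem_ofPred_eq, Set.mem_empty_iff_false, iff_false, not_and, not_not]
      intro _
      refine ⟨∅, by simp, by simp, by simp, by simp [hP]⟩
    rw [this]
    simp
  | succ k ih =>
    intro η hη
    obtain ⟨N, τ, hτ, hN⟩ := HasBesicovitchCovering.no_satelliteConfig (α := ℝ)
    have hη' : 0 < η / (6 * (N + 1)) := by positivity
    obtain ⟨ε₁, hε₁, hε₁', H₁⟩ := ih hη'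
    obtain ⟨ε₂, hε₂, hε₂', H₂⟩ := exists_volume_polynomial_small_le d hη'
    refine ⟨min ε₁ ε₂, by positivity, (min_le_left _ _).trans hε₁', ?_⟩
    intro α _ P f hdeg hch x₀ r₀ hr₀ hsup
    set ε := min ε₁ ε₂ with hε
    set η' := η / (6 * (N + 1)) with hη'def
    set A : Set ℝ := {z ∈ Metric.closedBall x₀ r₀ | ¬ IsMarked P f ε z} with hA
    have hne : ∀ W ∈ P, {y | 1 ≤ |(f W).eval y|}.Nonempty := fun W hW => by
      obtain ⟨y, _, hy⟩ := hsup W hW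
      exact ⟨y, hy⟩
    set R : α → ℝ → ℝ := fun W z => Metric.infDist z {y | 1 ≤ |(f W).eval y|} with hR
    have key : ∀ z : A, ∃ Γ ∈ P, 0 < R Γ z ∧ (∀ W ∈ P, R W z ≤ R Γ z) ∧ R Γ z ≤ 2 * r₀ := by
      rintro ⟨z, hz, hzm⟩
      have hex : ∃ W ∈ P, |(f W).eval z| < 1 := by
        by_contra! hcon
        refine hzm ⟨∅, by simp, by simp, by simp, fun W hW _ => ?_⟩
        exact ((min_le_left _ _).trans hε₁').trans (hcon W hW)
      obtain ⟨W, hW, hWz⟩ := hex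
      obtain ⟨Γ, hΓ, hmax⟩ := Finset.exists_max_image P (fun W => R W z) ⟨W, hW⟩
      refine ⟨Γ, hΓ, ?_, hmax, ?_⟩
      · exact ((infDist_one_le_abs_spec (f W) z (hne W hW)).2.1 hWz).trans_le (hmax W hW)
      · obtain ⟨y, hy, hy1⟩ := hsup Γ hΓ
        refine (Metric.infDist_le_dist_of_mem (x := z) (y := y) hy1).trans ?_
        rw [Metric.mem_closedBall] at hy hz
        calc dist z y ≤ dist z x₀ + dist y x₀ := dist_triangle_right _ _ _
          _ ≤ 2 * r₀ := by linarith
    choose Γ hΓP hpos hmax hle using key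
    have hball : ∀ z : A, volume (A ∩ Metric.closedBall (z : ℝ) (R (Γ z) z)) ≤
        ENNReal.ofReal (2 * η' * R (Γ z) z) := by
      intro z
      set P' := P.filter fun W => W ≠ Γ z ∧ (W ≤ Γ z ∨ Γ z ≤ W) with hP'
      have hmemP' : ∀ W, W ∈ P' ↔ W ∈ P ∧ W ≠ Γ z ∧ (W ≤ Γ z ∨ Γ z ≤ W) := fun W => by
        rw [hP', Finset.mem_filter]
      have hsup' : ∀ W ∈ P, ∃ y ∈ Metric.closedBall (z : ℝ) (R (Γ z) z), 1 ≤ |(f W).eval y| := by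
        intro W hW
        obtain ⟨y, hy, hy1⟩ := (infDist_one_le_abs_spec (f W) z (hne W hW)).1
        exact ⟨y, Metric.closedBall_subset_closedBall (hmax z W hW) hy, hy1⟩
      have h1 := H₁ P' f (fun W hW => hdeg W ((hmemP' W).1 hW).1) (by
        intro S hS hchS
        have hΓS : Γ z ∉ S := fun h => ((hmemP' _).1 (hS h)).2.1 rfl
        have := hch (insert (Γ z) S)
          (Finset.insert_subset (hΓP z) fun W hW => ((hmemP' W).1 (hS hW)).1) (by
            rw [Finset.coe_insert]
            exact hchS.insert fun W hW _ => ((hmemP' W).1 (hS hW)).2.2.symm)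
        rw [Finset.card_insert_of_notMem hΓS] at this
        omega) z (R (Γ z) z) (hpos z) fun W hW => hsup' W ((hmemP' W).1 hW).1
      have h2 := H₂ (f (Γ z)) (hdeg _ (hΓP z)) z (R (Γ z) z) (hpos z) (hsup' _ (hΓP z))
      have hsub : A ∩ Metric.closedBall (z : ℝ) (R (Γ z) z) ⊆
          {w ∈ Metric.closedBall (z : ℝ) (R (Γ z) z) | ¬ IsMarked P' f ε₁ w} ∪
          {w ∈ Metric.closedBall (z : ℝ) (R (Γ z) z) | |(f (Γ z)).eval w| < ε₂} := by
        rintro w ⟨hwA, hwB⟩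
        by_contra hcon
        simp only [Set.mem_union, Set.mem_ofPred_eq, not_or, not_and, not_not, not_lt] at hcon
        obtain ⟨hc1, hc2⟩ := hcon
        refine hwA.2 (IsMarked.of_comparable (hΓP z) hmemP' ?_ ?_ ((min_le_right _ _).trans (hc2 hwB)))
        · obtain ⟨S, a, b, c, e⟩ := hc1 hwB
          exact ⟨S, a, b, c, fun W hW hc => (min_le_left _ _).trans (e W hW hc)⟩
        · exact (infDist_one_le_abs_spec (f (Γ z)) z (hne _ (hΓP z))).2.2 (hpos z) w hwB
      refine (measure_mono hsub).trans ((measure_union_le _ _).trans ?_)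
      refine (add_le_add h1 h2).trans ?_
      have hp := hpos z
      rw [← ENNReal.ofReal_add (by positivity) (by positivity)]
      apply ENNReal.ofReal_le_ofReal
      linarith
    obtain ⟨s, hdisj, hcov⟩ := Besicovitch.exist_disjoint_covering_families hτ hN
      ({ c := fun z : A => (z : ℝ)
         r := fun z => R (Γ z) z
         rpos := hpos
         r_bound := 2 * r₀
         r_le := hle } : Besicovitch.BallPackage A ℝ)
    simp only [Subtype.range_coe_subtype] at hcov
    have hcount : ∀ i, (s i).Countable := fun i =>
      (hdisj i).countable_of_nonempty_interior fun z _ => by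
        rw [interior_closedBall _ (hpos z).ne']
        exact ⟨z, Metric.mem_ball_self (hpos z)⟩
    have hfam : ∀ i, volume (⋃ z ∈ s i, A ∩ Metric.closedBall (z : ℝ) (R (Γ z) z)) ≤
        ENNReal.ofReal (6 * η' * r₀) := by
      intro i
      have hcs := (hcount i)
      refine (measure_biUnion_le _ hcs _).trans ?_
      calc ∑' z : s i, volume (A ∩ Metric.closedBall (z : ℝ) (R (Γ z) z))
          ≤ ∑' z : s i, ENNReal.ofReal η' * volume (Metric.closedBall (z : ℝ) (R (Γ z) z)) := by
            refine ENNReal.tsum_le_tsum fun z => (hball z).trans ?_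
            rw [Real.volume_closedBall, ← ENNReal.ofReal_mul (by positivity)]
            apply ENNReal.ofReal_le_ofReal
            linarith
        _ = ENNReal.ofReal η' * volume (⋃ z ∈ s i, Metric.closedBall (z : ℝ) (R (Γ z) z)) := by
            rw [ENNReal.tsum_mul_left, measure_biUnion hcs (hdisj i)
              fun _ _ => measurableSet_closedBall]
        _ ≤ ENNReal.ofReal η' * volume (Metric.closedBall x₀ (3 * r₀)) := by
            gcongr
            refine Set.iUnion₂_subset fun z _ => Metric.closedBall_subset_closedBall' ?_
            have h1 := z.2.1
            have h2 := hle z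
            rw [Metric.mem_closedBall] at h1
            linarith
        _ = _ := by
            rw [Real.volume_closedBall, ← ENNReal.ofReal_mul (by positivity)]
            congr 1
            ring
    have hAsub : A ⊆ ⋃ i, ⋃ z ∈ s i, A ∩ Metric.closedBall (z : ℝ) (R (Γ z) z) := by
      intro w hw
      have := hcov hw
      simp only [Set.mem_iUnion, Set.mem_inter_iff] at this ⊢
      obtain ⟨i, z, hz, hwz⟩ := this
      exact ⟨i, z, hz, hw, Metric.ball_subset_closedBall hwz⟩
    refine (measure_mono hAsub).trans ((measure_iUnion_le _).trans ?_)
    refine (ENNReal.tsum_le_tsum hfam).trans ?_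
    rw [tsum_fintype, Finset.sum_const, Finset.card_univ, Fintype.card_fin, nsmul_eq_mul,
      ← ENNReal.ofReal_natCast, ← ENNReal.ofReal_mul (by positivity)]
    apply ENNReal.ofReal_le_ofReal
    have : (N : ℝ) / (N + 1) ≤ 1 := by
      rw [div_le_one (by positivity)]; linarith
    calc (N : ℝ) * (6 * η' * r₀) = (N / (N + 1)) * (η * r₀) := by
          rw [hη'def]; field_simp
      _ ≤ 1 * (η * r₀) := by gcongr
      _ = η * r₀ := one_mul _

/-- The sum of the squares of all maximal minors of a matrix, over all ordered choices of rows. -/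
def minorSq {R : Type*} [CommRing R] {m j : ℕ} (M : Matrix (Fin m) (Fin j) R) : R :=
  ∑ s : Fin j → Fin m, (M.submatrix s id).det ^ 2

lemma minorSq_map {R S : Type*} [CommRing R] [CommRing S] (g : R →+* S) {m j : ℕ}
    (M : Matrix (Fin m) (Fin j) R) : minorSq (M.map g) = g (minorSq M) := by
  simp only [minorSq, map_sum, map_pow, RingHom.map_det]
  rfl

lemma minorSq_mul {R : Type*} [CommRing R] {m j : ℕ} (M : Matrix (Fin m) (Fin j) R)
    (N : Matrix (Fin j) (Fin j) R) : minorSq (M * N) = minorSq M * N.det ^ 2 := by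
  simp only [minorSq, Finset.sum_mul, ← mul_pow]
  refine Finset.sum_congr rfl fun s _ => ?_
  rw [← Matrix.det_mul]
  rfl

lemma sq_det_submatrix_le_minorSq {m j : ℕ} (M : Matrix (Fin m) (Fin j) ℝ) (s : Fin j → Fin m) :
    (M.submatrix s id).det ^ 2 ≤ minorSq M :=
  Finset.single_le_sum (f := fun s => (M.submatrix s id).det ^ 2) (fun _ _ => sq_nonneg _)
    (Finset.mem_univ s)

lemma minorSq_nonneg {m j : ℕ} (M : Matrix (Fin m) (Fin j) ℝ) : 0 ≤ minorSq M :=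
  Finset.sum_nonneg fun _ _ => sq_nonneg _

lemma minorSq_le_of_abs_le {m j : ℕ} (M : Matrix (Fin m) (Fin (j + 1)) ℝ) {b : ℝ}
    (hb : ∀ i, |M i 0| ≤ b) :
    minorSq M ≤ (j + 1) ^ 2 * m ^ (j + 1) * b ^ 2 * minorSq (M.submatrix id Fin.succ) := by
  set G := minorSq (M.submatrix id Fin.succ) with hG
  have hG0 : 0 ≤ G := minorSq_nonneg _
  have hterm : ∀ s : Fin (j + 1) → Fin m,
      (M.submatrix s id).det ^ 2 ≤ ((j + 1) * (b * √G)) ^ 2 := by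
    intro s
    have hb0 : 0 ≤ b := (abs_nonneg _).trans (hb (s 0))
    rw [← sq_abs]
    refine pow_le_pow_left₀ (abs_nonneg _) ?_ 2
    rw [Matrix.det_succ_column_zero]
    refine (Finset.abs_sum_le_sum_abs _ _).trans ?_
    have : ∀ i ∈ (Finset.univ : Finset (Fin (j + 1))), |(-1) ^ (i : ℕ) * M.submatrix s id i 0 *
        ((M.submatrix s id).submatrix i.succAbove Fin.succ).det| ≤ b * √G := by
      intro i _
      rw [abs_mul, abs_mul, abs_pow, abs_neg, abs_one, one_pow, one_mul]
      refine mul_le_mul (hb _) (Real.abs_le_sqrt ?_) (abs_nonneg _) hb0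
      exact sq_det_submatrix_le_minorSq (M.submatrix id Fin.succ) (s ∘ i.succAbove)
    refine (Finset.sum_le_sum this).trans (le_of_eq ?_)
    simp
  refine (Finset.sum_le_sum fun s _ => hterm s).trans (le_of_eq ?_)
  simp only [Finset.sum_const, Finset.card_univ, Fintype.card_fun, Fintype.card_fin, nsmul_eq_mul]
  rw [mul_pow, mul_pow, Real.sq_sqrt hG0]
  push_cast
  ring

lemma exists_det_submatrix_ne_zero {m j : ℕ} (M : Matrix (Fin m) (Fin j) ℝ)
    (hM : LinearIndependent ℝ M.col) : ∃ s : Fin j → Fin m, (M.submatrix s id).det ≠ 0 := by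
  have hr : Module.finrank ℝ (Submodule.span ℝ (Set.range M.row)) = j := by
    rw [← Matrix.rank_eq_finrank_span_row, ← Matrix.rank_transpose]
    have := LinearIndependent.rank_matrix (M := M.transpose) hM
    simpa using this
  obtain ⟨f, hf, -, hli⟩ := Submodule.exists_fun_fin_finrank_span_eq ℝ (Set.range M.row)
  choose s hs using hf
  refine ⟨s ∘ Fin.cast hr.symm, ?_⟩
  have : LinearIndependent ℝ (M.submatrix (s ∘ Fin.cast hr.symm) id).row := by
    have heq : (M.submatrix (s ∘ Fin.cast hr.symm) id).row = f ∘ Fin.cast hr.symm := by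
      ext k l
      simp only [Function.comp_apply, ← hs]
      rfl
    rw [heq]
    exact hli.comp (Fin.cast hr.symm) (Fin.cast_injective _)
  rw [Matrix.linearIndependent_rows_iff_isUnit, Matrix.isUnit_iff_isUnit_det] at this
  exact this.ne_zero

/-- The integer matrix whose columns are the given integer vectors. -/
def intMat {m j : ℕ} (T : Fin j → Fin m → ℤ) : Matrix (Fin m) (Fin j) ℤ :=
  Matrix.of fun i l => T l i

/-- The real matrix whose columns are the given integer vectors. -/
def realMat {m j : ℕ} (T : Fin j → Fin m → ℤ) : Matrix (Fin m) (Fin j) ℝ :=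
  (intMat T).map (Int.castRingHom ℝ)

/-- `T` consists of integer vectors forming a real basis of `W`. -/
def IsIntBasis {m j : ℕ} (T : Fin j → Fin m → ℤ) (W : Submodule ℝ (Fin m → ℝ)) : Prop :=
  LinearIndependent ℝ (realMat T).col ∧ Submodule.span ℝ (Set.range (realMat T).col) = W

lemma minorSq_realMat_pos {m j : ℕ} {T : Fin j → Fin m → ℤ}
    (hT : LinearIndependent ℝ (realMat T).col) : 0 < minorSq (realMat T) := by
  obtain ⟨s, hs⟩ := exists_det_submatrix_ne_zero _ hT
  exact (by positivity : 0 < ((realMat T).submatrix s id).det ^ 2).trans_le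
    (sq_det_submatrix_le_minorSq _ s)

lemma IsIntBasis.finrank_eq {m j : ℕ} {T : Fin j → Fin m → ℤ} {W : Submodule ℝ (Fin m → ℝ)}
    (hT : IsIntBasis T W) : Module.finrank ℝ W = j := by
  rw [← hT.2, finrank_span_eq_card hT.1, Fintype.card_fin]

lemma IsIntBasis.exists_mul_eq {m j : ℕ} {T T' : Fin j → Fin m → ℤ} {W : Submodule ℝ (Fin m → ℝ)}
    (hT : IsIntBasis T W) (hT' : IsIntBasis T' W) :
    ∃ N : Matrix (Fin j) (Fin j) ℝ, realMat T' = realMat T * N := by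
  have : ∀ l, ∃ c : Fin j → ℝ, ∑ k, c k • (realMat T).col k = (realMat T').col l := by
    intro l
    rw [← Submodule.mem_span_range_iff_exists_fun, hT.2, ← hT'.2]
    exact Submodule.subset_span ⟨l, rfl⟩
  choose c hc using this
  refine ⟨Matrix.of fun k l => c l k, ?_⟩
  ext i l
  have := congrFun (hc l) i
  simp only [Finset.sum_apply, Pi.smul_apply, smul_eq_mul, Matrix.col_apply] at this
  rw [← this, Matrix.mul_apply]
  exact Finset.sum_congr rfl fun k _ => mul_comm _ _

/-- Among the integer bases of a subspace there is one minimizing all sums of squares of minors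
simultaneously. -/
lemma exists_isIntBasis_minimal {m : ℕ} {W : Submodule ℝ (Fin m → ℝ)}
    (hW : ∃ (j : ℕ) (T : Fin j → Fin m → ℤ), IsIntBasis T W) :
    ∃ (j : ℕ) (T : Fin j → Fin m → ℤ), IsIntBasis T W ∧
      ∀ (j' : ℕ) (T' : Fin j' → Fin m → ℤ), IsIntBasis T' W → ∀ A : Matrix (Fin m) (Fin m) ℝ,
        minorSq (A * realMat T) ≤ minorSq (A * realMat T') := by
  obtain ⟨j, hj⟩ := hW
  have hne : {T : Fin j → Fin m → ℤ | IsIntBasis T W}.Nonempty := hj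
  obtain ⟨T, hT, hmin⟩ := exists_minimalFor_of_wellFoundedLT (fun T => IsIntBasis T W)
    (fun T : Fin j → Fin m → ℤ => (minorSq (intMat T)).toNat) hne
  refine ⟨j, T, hT, ?_⟩
  intro j' T' hT' A
  obtain rfl : j = j' := by rw [← hT.finrank_eq, hT'.finrank_eq]
  obtain ⟨N, hN⟩ := hT.exists_mul_eq hT'
  have hle : minorSq (realMat T) ≤ minorSq (realMat T') := by
    have h1 : (minorSq (intMat T)).toNat ≤ (minorSq (intMat T')).toNat :=
      (le_total _ _).elim id (hmin hT')
    have hnn : ∀ T : Fin j → Fin m → ℤ, 0 ≤ minorSq (intMat T) := fun T =>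
      Finset.sum_nonneg fun _ _ => sq_nonneg _
    have h2 : minorSq (intMat T) ≤ minorSq (intMat T') := by
      have := hnn T
      have := hnn T'
      omega
    rw [realMat, realMat, minorSq_map, minorSq_map]
    simpa using h2
  have hpos := minorSq_realMat_pos hT.1
  rw [hN, minorSq_mul] at hle
  have hdet : 1 ≤ N.det ^ 2 := by
    by_contra! hlt
    nlinarith
  rw [hN, ← Matrix.mul_assoc, minorSq_mul]
  exact le_mul_of_one_le_right (minorSq_nonneg _) hdet

/-- The unimodular matrix sending the coefficient vector `v` of a polynomial `P` to the vector
`(Q ^ n * P(x), v₁ / Q, …, vₙ / Q)`. -/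
noncomputable def twistMat (n : ℕ) (Q x : ℝ) : Matrix (Fin (n + 1)) (Fin (n + 1)) ℝ :=
  Matrix.of fun i l => if i = 0 then Q ^ n * x ^ (l : ℕ) else if i = l then Q⁻¹ else 0

/-- The matrix `twistMat n Q x` with the variable `X` in place of `x`. -/
noncomputable def twistMatX (n : ℕ) (Q : ℝ) :
    Matrix (Fin (n + 1)) (Fin (n + 1)) (Polynomial ℝ) :=
  Matrix.of fun i l => if i = 0 then Polynomial.C (Q ^ n) * Polynomial.X ^ (l : ℕ)
    else if i = l then Polynomial.C Q⁻¹ else 0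

lemma twistMatX_map_eval (n : ℕ) (Q x : ℝ) :
    (twistMatX n Q).map (Polynomial.evalRingHom x) = twistMat n Q x := by
  ext i l
  simp only [twistMatX, twistMat, Matrix.map_apply, Matrix.of_apply]
  split_ifs <;> simp

lemma det_twistMat (n : ℕ) {Q : ℝ} (hQ : 0 < Q) (x : ℝ) : (twistMat n Q x).det = 1 := by
  rw [Matrix.det_of_isUpperTriangular, Fin.prod_univ_succ]
  · simp [twistMat, hQ.ne']
  · intro i l hil
    simp only [id] at hil
    have h0 : i ≠ 0 := (lt_of_le_of_lt (Fin.zero_le l) hil).ne'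
    simp [twistMat, h0, hil.ne']

lemma twistMat_mulVec_zero (n : ℕ) (Q x : ℝ) (v : Fin (n + 1) → ℝ) :
    (twistMat n Q x).mulVec v 0 = Q ^ n * ∑ l, v l * x ^ (l : ℕ) := by
  simp only [Matrix.mulVec, dotProduct, twistMat, Matrix.of_apply, if_true, Finset.mul_sum]
  exact Finset.sum_congr rfl fun _ _ => by ring

lemma twistMat_mulVec_of_ne_zero (n : ℕ) (Q x : ℝ) (v : Fin (n + 1) → ℝ) {i : Fin (n + 1)}
    (hi : i ≠ 0) : (twistMat n Q x).mulVec v i = v i / Q := by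
  simp only [Matrix.mulVec, dotProduct, twistMat, Matrix.of_apply, if_neg hi, ite_mul, zero_mul,
    Finset.sum_ite_eq, Finset.mem_univ, if_true]
  rw [div_eq_inv_mul]

/-- The squared covolume, as a polynomial in `x`, of the lattice generated by the images of the
vectors of `T` under `twistMat n Q x`. -/
noncomputable def covolX (n : ℕ) (Q : ℝ) {j : ℕ} (T : Fin j → Fin (n + 1) → ℤ) : Polynomial ℝ :=
  minorSq (twistMatX n Q * (realMat T).map Polynomial.C)

lemma eval_covolX (n : ℕ) (Q x : ℝ) {j : ℕ} (T : Fin j → Fin (n + 1) → ℤ) :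
    (covolX n Q T).eval x = minorSq (twistMat n Q x * realMat T) := by
  rw [covolX, ← Polynomial.coe_evalRingHom, ← minorSq_map, Matrix.map_mul, twistMatX_map_eval]
  congr 2
  ext i l
  simp

lemma natDegree_covolX_le (n : ℕ) (Q : ℝ) {j : ℕ} (T : Fin j → Fin (n + 1) → ℤ) :
    (covolX n Q T).natDegree ≤ 2 * (j * n) := by
  have hentry : ∀ i l, ((twistMatX n Q * (realMat T).map Polynomial.C) i l).natDegree ≤ n := by
    intro i l
    rw [Matrix.mul_apply]
    refine Polynomial.natDegree_sum_le_of_forall_le _ _ fun k _ => ?_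
    refine (Polynomial.natDegree_mul_C_le _ _).trans ?_
    simp only [twistMatX, Matrix.of_apply]
    split_ifs
    · exact (Polynomial.natDegree_C_mul_X_pow_le _ _).trans (Nat.lt_succ_iff.1 k.2)
    · simp
    · simp
  refine Polynomial.natDegree_sum_le_of_forall_le _ _ fun s _ => ?_
  refine Polynomial.natDegree_pow_le_of_le 2 ?_
  rw [Matrix.det_apply]
  refine Polynomial.natDegree_sum_le_of_forall_le _ _ fun σ _ => ?_
  refine (Polynomial.natDegree_smul_le _ _).trans ?_
  refine (Polynomial.natDegree_prod_le _ _).trans ?_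
  refine (Finset.sum_le_sum fun i _ => hentry _ _).trans ?_
  simp

/-- Nonzero integer polynomials of bounded degree are not uniformly small on an interval. -/
lemma exists_le_abs_int_polynomial (n : ℕ) (x : ℝ) {r : ℝ} (hr : 0 < r) :
    ∃ c : ℝ, 0 < c ∧ ∀ a : Fin (n + 1) → ℤ, a ≠ 0 →
      ∃ y ∈ Metric.closedBall x r, c ≤ |∑ i, (a i : ℝ) * y ^ (i : ℕ)| := by
  set p : Fin (n + 1) → ℝ := fun l => x + r * (l : ℕ) / (n + 1) with hp
  have hpinj : Function.Injective p := by
    intro k l hkl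
    simp only [hp, add_right_inj] at hkl
    rw [div_left_inj' (by positivity), mul_right_inj' hr.ne'] at hkl
    exact Fin.ext (by exact_mod_cast hkl)
  have hdet : (Matrix.vandermonde p).det ≠ 0 := Matrix.det_vandermonde_ne_zero_iff.2 hpinj
  have hinj : Function.Injective (Matrix.vandermonde p).mulVec :=
    Matrix.mulVec_injective_iff_isUnit.2 ((Matrix.isUnit_iff_isUnit_det _).2 hdet.isUnit)
  obtain ⟨K, hK, hanti⟩ := LinearMap.exists_antilipschitzWith (Matrix.vandermonde p).mulVecLin
    (LinearMap.ker_eq_bot.2 hinj)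
  refine ⟨1 / (2 * K), by positivity, ?_⟩
  intro a ha
  by_contra! hcon
  obtain ⟨i, hi⟩ := Function.ne_iff.1 ha
  have h1 : (1 : ℝ) ≤ ‖fun l => (a l : ℝ)‖ := by
    refine le_trans ?_ (norm_le_pi_norm _ i)
    rw [Real.norm_eq_abs]
    exact_mod_cast Int.one_le_abs hi
  have h2 := hanti.le_mul_dist (fun l => (a l : ℝ)) 0
  rw [dist_zero_right, map_zero, dist_zero_right] at h2
  have h3 : ‖(Matrix.vandermonde p).mulVecLin (fun l => (a l : ℝ))‖ ≤ 1 / (2 * K) := by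
    refine (pi_norm_le_iff_of_nonneg (by positivity)).2 fun l => ?_
    have hl : p l ∈ Metric.closedBall x r := by
      rw [Metric.mem_closedBall, Real.dist_eq, hp]
      have : ((l : ℕ) : ℝ) / (n + 1) ≤ 1 := by
        rw [div_le_one (by positivity)]
        exact_mod_cast l.2.le
      rw [add_sub_cancel_left, abs_of_nonneg (by positivity), mul_div_assoc]
      exact mul_le_of_le_one_right hr.le this
    refine le_trans (le_of_eq ?_) (hcon _ hl).le
    rw [Real.norm_eq_abs]
    congr 1
    simp only [Matrix.mulVecLin_apply, Matrix.mulVec, dotProduct, Matrix.vandermonde_apply]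
    exact Finset.sum_congr rfl fun _ _ => mul_comm _ _
  have h4 : (K : ℝ) * (1 / (2 * K)) = 1 / 2 := by
    have : (K : ℝ) ≠ 0 := by exact_mod_cast hK.ne'
    field_simp
  have h5 : (K : ℝ) * ‖(Matrix.vandermonde p).mulVecLin (fun l => (a l : ℝ))‖ ≤
      K * (1 / (2 * K)) := by gcongr
  linarith

lemma det_updateRow_sum_smul {R ι : Type*} [CommRing R] {j : ℕ} (A : Matrix (Fin j) (Fin j) R)
    (k : Fin j) (t : Finset ι) (c : ι → R) (v : ι → Fin j → R) :
    (A.updateRow k (∑ i ∈ t, c i • v i)).det = ∑ i ∈ t, c i * (A.updateRow k (v i)).det := by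
  classical
  induction t using Finset.induction_on with
  | empty => exact Matrix.det_eq_zero_of_row_eq_zero k fun l => by simp
  | insert i t hi ih =>
    rw [Finset.sum_insert hi, Finset.sum_insert hi, Matrix.det_updateRow_add,
      Matrix.det_updateRow_smul, ih]

lemma det_twistMat_mul_submatrix {n j : ℕ} (Q x : ℝ) (M : Matrix (Fin (n + 1)) (Fin j) ℝ)
    (s : Fin j → Fin (n + 1)) (k₀ : Fin j) (hs : ∀ k, k ≠ k₀ → s k ≠ 0) :
    ((twistMat n Q x * M).submatrix (Function.update s k₀ 0) id).det =
      Q ^ n * (Q⁻¹) ^ (j - 1) *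
        ∑ i, (M.submatrix (Function.update s k₀ i) id).det * x ^ (i : ℕ) := by
  have hsum : ∑ i, (M.submatrix (Function.update s k₀ i) id).det * x ^ (i : ℕ) =
      (Matrix.updateRow (M.submatrix s id) k₀ (∑ i : Fin (n + 1), x ^ (i : ℕ) • M.row i)).det := by
    rw [det_updateRow_sum_smul]
    refine Finset.sum_congr rfl fun i _ => ?_
    rw [mul_comm]
    congr 2
    ext k l
    by_cases hk : k = k₀
    · subst hk; simp
    · simp [hk]
  have hmat : (twistMat n Q x * M).submatrix (Function.update s k₀ 0) id =
      Matrix.diagonal (fun k => if k = k₀ then Q ^ n else Q⁻¹) *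
        Matrix.updateRow (M.submatrix s id) k₀ (∑ i : Fin (n + 1), x ^ (i : ℕ) • M.row i) := by
    ext k l
    rw [Matrix.diagonal_mul]
    by_cases hk : k = k₀
    · subst hk
      simp only [Matrix.submatrix_apply, Function.update_self, Matrix.mul_apply, twistMat,
        Matrix.of_apply, if_true, id, Matrix.updateRow_self, Finset.sum_apply, Pi.smul_apply, Matrix.row_apply,
        smul_eq_mul, Finset.mul_sum, mul_assoc]
    · simp [hk, Matrix.mul_apply, twistMat, hs k hk]
  rw [hsum, hmat, Matrix.det_mul, Matrix.det_diagonal, Finset.prod_ite]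
  simp [Finset.filter_ne', Finset.filter_eq']

/-- For large `Q`, all covolume functions exceed `1` somewhere on a given interval. -/
lemma exists_one_le_covolX (n : ℕ) (x : ℝ) {r : ℝ} (hr : 0 < r) :
    ∃ Q₀ : ℝ, 1 ≤ Q₀ ∧ ∀ Q : ℝ, Q₀ ≤ Q → ∀ (j : ℕ) (T : Fin j → Fin (n + 1) → ℤ), 0 < j →
      LinearIndependent ℝ (realMat T).col →
      ∃ y ∈ Metric.closedBall x r, 1 ≤ |(covolX n Q T).eval y| := by
  obtain ⟨c, hc, H⟩ := exists_le_abs_int_polynomial n x hr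
  refine ⟨max 1 (1 / c), le_max_left _ _, ?_⟩
  intro Q hQ j T hj hT
  have hQ1 : 1 ≤ Q := (le_max_left _ _).trans hQ
  have hQc : 1 / c ≤ Q := (le_max_right _ _).trans hQ
  have hQ0 : 0 < Q := by linarith
  obtain ⟨s, hs⟩ := exists_det_submatrix_ne_zero _ hT
  have hInt : ∀ s : Fin j → Fin (n + 1),
      ((realMat T).submatrix s id).det = (((intMat T).submatrix s id).det : ℝ) := by
    intro s
    change _ = Int.castRingHom ℝ _
    rw [RingHom.map_det]
    rfl
  suffices hsuff : ∃ y ∈ Metric.closedBall x r, ∃ s : Fin j → Fin (n + 1),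
      1 ≤ |((twistMat n Q y * realMat T).submatrix s id).det| by
    obtain ⟨y, hy, s, hsy⟩ := hsuff
    refine ⟨y, hy, ?_⟩
    rw [eval_covolX, abs_of_nonneg (minorSq_nonneg _)]
    refine le_trans ?_ (sq_det_submatrix_le_minorSq _ s)
    rwa [one_le_sq_iff_one_le_abs]
  have hjn : j ≤ n + 1 := by
    have := hT.fintype_card_le_finrank
    simpa using this
  rcases hjn.eq_or_lt with rfl | hjn
  · refine ⟨x, Metric.mem_closedBall_self hr.le, s, ?_⟩
    have hinj : Function.Injective s := by
      intro k l hkl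
      by_contra hne
      exact hs (Matrix.det_zero_of_row_eq hne (by ext; simp [hkl]))
    have hbij : Function.Bijective s := Finite.injective_iff_bijective.1 hinj
    have hperm : (twistMat n Q x * realMat T).submatrix s id =
        (twistMat n Q x * realMat T).submatrix (Equiv.ofBijective s hbij) id := rfl
    have hperm' : (realMat T).submatrix s id =
        (realMat T).submatrix (Equiv.ofBijective s hbij) id := rfl
    rw [hperm, Matrix.det_permute, abs_mul, Matrix.det_mul, det_twistMat n hQ0, one_mul, ← abs_mul,
      ← Matrix.det_permute, ← hperm', hInt, ← Int.cast_abs]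
    rw [hInt] at hs
    exact_mod_cast Int.one_le_abs (by exact_mod_cast hs)
  · obtain ⟨k₀, hk₀⟩ : ∃ k₀, ∀ k, k ≠ k₀ → s k ≠ 0 := by
      by_cases h0 : ∃ k, s k = 0
      · obtain ⟨k₀, hk₀⟩ := h0
        refine ⟨k₀, fun k hk hk0 => hs (Matrix.det_zero_of_row_eq hk ?_)⟩
        ext
        simp [hk₀, hk0]
      · push Not at h0
        exact ⟨⟨0, hj⟩, fun k _ => h0 k⟩
    set a : Fin (n + 1) → ℤ := fun i => ((intMat T).submatrix (Function.update s k₀ i) id).det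
      with ha
    have ha0 : a ≠ 0 := by
      intro h
      have := congrFun h (s k₀)
      simp only [ha, Function.update_eq_self, Pi.zero_apply] at this
      rw [hInt, this] at hs
      simp at hs
    obtain ⟨y, hy, hcy⟩ := H a ha0
    refine ⟨y, hy, Function.update s k₀ 0, ?_⟩
    rw [det_twistMat_mul_submatrix Q y _ s k₀ hk₀]
    simp only [hInt]
    rw [abs_mul]
    have hQpow : Q ≤ |Q ^ n * Q⁻¹ ^ (j - 1)| := by
      rw [abs_of_nonneg (by positivity), inv_pow, ← div_eq_mul_inv, le_div_iff₀ (by positivity),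
        ← pow_succ']
      exact pow_le_pow_right₀ hQ1 (by omega)
    calc 1 = 1 / c * c := by field_simp
      _ ≤ Q * c := by gcongr
      _ ≤ _ := by gcongr

/-- An integer vector regarded as a real one. -/
def realVec {m : ℕ} (v : Fin m → ℤ) : Fin m → ℝ := fun i => (v i : ℝ)

lemma realVec_ne_zero {m : ℕ} {v : Fin m → ℤ} (hv : v ≠ 0) : realVec v ≠ 0 := by
  obtain ⟨i, hi⟩ := Function.ne_iff.1 hv
  refine Function.ne_iff.2 ⟨i, ?_⟩
  simpa [realVec] using hi

lemma exists_isIntBasis_span {m : ℕ} (s : Set (Fin m → ℤ)) :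
    ∃ (j : ℕ) (T : Fin j → Fin m → ℤ), IsIntBasis T (Submodule.span ℝ (realVec '' s)) := by
  obtain ⟨f, hf, hspan, hli⟩ := Submodule.exists_fun_fin_finrank_span_eq ℝ (realVec '' s)
  choose T hT using hf
  have hcol : (realMat T).col = f := by
    ext l i
    rw [← (hT l).2]
    rfl
  exact ⟨_, T, by rwa [hcol], by rw [hcol, hspan]⟩

lemma realMat_cons_col {m j : ℕ} (v : Fin m → ℤ) (T : Fin j → Fin m → ℤ) :
    (realMat (Fin.cons v T : Fin (j + 1) → Fin m → ℤ)).col =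
      Fin.cons (realVec v) (realMat T).col := by
  ext l i
  refine Fin.cases ?_ (fun l => ?_) l
  · simp [realMat, intMat, realVec]
  · simp [realMat, intMat]

lemma IsIntBasis.cons {m j : ℕ} {T : Fin j → Fin m → ℤ} {s : Set (Fin m → ℤ)} {v : Fin m → ℤ}
    (hT : IsIntBasis T (Submodule.span ℝ (realVec '' s)))
    (hv : realVec v ∉ Submodule.span ℝ (realVec '' s)) :
    IsIntBasis (Fin.cons v T : Fin (j + 1) → Fin m → ℤ)
      (Submodule.span ℝ (realVec '' insert v s)) := by
  refine ⟨?_, ?_⟩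
  · rw [realMat_cons_col]
    exact hT.1.finCons (by rwa [hT.2])
  · rw [realMat_cons_col, Fin.range_cons, Set.image_insert_eq, Submodule.span_insert,
      Submodule.span_insert, hT.2]

lemma card_le_of_isChain_submodule {m : ℕ} (S : Finset (Submodule ℝ (Fin m → ℝ)))
    (hS : IsChain (· ≤ ·) (S : Set (Submodule ℝ (Fin m → ℝ)))) (hbot : ∀ W ∈ S, W ≠ ⊥) :
    S.card ≤ m := by
  have : S.card ≤ (Finset.Icc 1 m).card := by
    refine Finset.card_le_card_of_injOn (fun W => Module.finrank ℝ W) ?_ ?_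
    · intro W hW
      rw [Finset.coe_Icc, Set.mem_Icc]
      refine ⟨Nat.one_le_iff_ne_zero.2 fun h => hbot W hW (Submodule.finrank_eq_zero.1 h), ?_⟩
      simpa using Submodule.finrank_le W
    · intro U hU W hW hUW
      rcases hS.total hU hW with h | h
      · exact Submodule.eq_of_le_of_finrank_eq h hUW
      · exact (Submodule.eq_of_le_of_finrank_eq h hUW.symm).symm
  simpa using this

/-- If `x` is marked for the covolume polynomials of a family of rational subspaces, then no integer
vector producing these subspaces becomes short under `twistMat n Q x`. -/
lemma le_of_isMarked {n : ℕ} {Q ε δ x : ℝ} {F : Finset (Fin (n + 1) → ℤ)}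
    {P : Finset (Submodule ℝ (Fin (n + 1) → ℝ))}
    (hP : ∀ W, W ∈ P ↔ W ≠ ⊥ ∧ ∃ s ⊆ F, Submodule.span ℝ (realVec '' (s : Set _)) = W)
    {f : Submodule ℝ (Fin (n + 1) → ℝ) → Polynomial ℝ}
    (hf : ∀ W ∈ P, ∃ (j : ℕ) (T : Fin j → Fin (n + 1) → ℤ), IsIntBasis T W ∧ f W = covolX n Q T ∧
      ∀ (j' : ℕ) (T' : Fin j' → Fin (n + 1) → ℤ), IsIntBasis T' W →
        ∀ A : Matrix (Fin (n + 1)) (Fin (n + 1)) ℝ,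
          minorSq (A * realMat T) ≤ minorSq (A * realMat T'))
    (hx : IsMarked P f ε x) {v : Fin (n + 1) → ℤ} (hv : v ∈ F) (hv0 : v ≠ 0)
    (hδ : ∀ i, |(twistMat n Q x).mulVec (realVec v) i| ≤ δ) :
    ε ≤ (n + 1) ^ 2 * (n + 1) ^ (n + 1) * δ ^ 2 := by
  classical
  obtain ⟨S, hSP, hS, hS1, hSε⟩ := hx
  have hU : ∃ U : Submodule ℝ (Fin (n + 1) → ℝ), realVec v ∉ U ∧
      (∀ Y ∈ S, realVec v ∉ Y → Y ≤ U) ∧ (∀ Y ∈ S, realVec v ∈ Y → U ≤ Y) ∧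
      (∃ s ⊆ F, Submodule.span ℝ (realVec '' (s : Set _)) = U) ∧
      ∃ (j : ℕ) (T : Fin j → Fin (n + 1) → ℤ), IsIntBasis T U ∧
        minorSq (twistMat n Q x * realMat T) ≤ 1 := by
    rcases (S.filter fun Y => realVec v ∉ Y).eq_empty_or_nonempty with he | hne
    · refine ⟨⊥, by simpa using realVec_ne_zero hv0, ?_, fun _ _ _ => bot_le, ⟨∅, by simp⟩, 0,
        Fin.elim0, ⟨linearIndependent_empty_type, ?_⟩, ?_⟩
      · intro Y hY hvY
        have : Y ∈ S.filter fun Y => realVec v ∉ Y := Finset.mem_filter.2 ⟨hY, hvY⟩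
        rw [he] at this
        simp at this
      · rw [Set.range_eq_empty, Submodule.span_empty]
      · simp [minorSq]
    · obtain ⟨U, hUmax⟩ := Finset.exists_maximal hne
      obtain ⟨hUS, hvU⟩ := Finset.mem_filter.1 hUmax.1
      refine ⟨U, hvU, ?_, ?_, ((hP U).1 (hSP hUS)).2, ?_⟩
      · intro Y hY hvY
        rcases hS.total hY hUS with h | h
        · exact h
        · exact hUmax.2 (Finset.mem_filter.2 ⟨hY, hvY⟩) h
      · intro Y hY hvY
        rcases hS.total hY hUS with h | h
        · exact absurd (h hvY) hvU
        · exact h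
      · obtain ⟨j, T, hT, hfT, -⟩ := hf U (hSP hUS)
        refine ⟨j, T, hT, ?_⟩
        have := hS1 U hUS
        rw [hfT, eval_covolX] at this
        exact (le_abs_self _).trans this
  obtain ⟨U, hvU, hU1, hU2, ⟨s, hsF, rfl⟩, j, T, hT, hT1⟩ := hU
  set W := Submodule.span ℝ (realVec '' ((insert v s : Finset _) : Set (Fin (n + 1) → ℤ))) with hW
  have hvW : realVec v ∈ W := Submodule.subset_span ⟨v, by simp, rfl⟩
  have hUW : Submodule.span ℝ (realVec '' (s : Set _)) ≤ W :=
    Submodule.span_mono (Set.image_mono (by simp))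
  have hWP : W ∈ P := by
    refine (hP W).2 ⟨fun h => ?_, insert v s, Finset.insert_subset hv hsF, rfl⟩
    rw [h, Submodule.mem_bot] at hvW
    exact realVec_ne_zero hv0 hvW
  have hcomp : ∀ Y ∈ S, Y ≤ W ∨ W ≤ Y := by
    intro Y hY
    by_cases hvY : realVec v ∈ Y
    · right
      rw [hW, Finset.coe_insert, Set.image_insert_eq, Submodule.span_insert, sup_le_iff]
      exact ⟨by simpa using hvY, hU2 Y hY hvY⟩
    · exact Or.inl ((hU1 Y hY hvY).trans hUW)
  obtain ⟨j', T', hT', hfT', hmin⟩ := hf W hWP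
  have hε := hSε W hWP hcomp
  rw [hfT', eval_covolX, abs_of_nonneg (minorSq_nonneg _)] at hε
  have hcons := hT.cons hvU
  rw [← Finset.coe_insert, ← hW] at hcons
  have hj : j + 1 ≤ n + 1 := by
    have := hcons.1.fintype_card_le_finrank
    simpa using this
  refine hε.trans ((hmin _ _ hcons _).trans ?_)
  have hcol0 : ∀ i, (twistMat n Q x * realMat (Fin.cons v T : Fin (j + 1) → Fin (n + 1) → ℤ)) i 0 =
      (twistMat n Q x).mulVec (realVec v) i := fun i => rfl
  have hsub : (twistMat n Q x * realMat (Fin.cons v T : Fin (j + 1) → Fin (n + 1) → ℤ)).submatrix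
      id Fin.succ = twistMat n Q x * realMat T := rfl
  refine (minorSq_le_of_abs_le _ (b := δ) fun i => by rw [hcol0]; exact hδ i).trans ?_
  rw [hsub]
  have hj' : ((j : ℝ) + 1) ≤ n + 1 := by exact_mod_cast hj
  have hpow : (((n + 1 : ℕ) : ℝ)) ^ (j + 1) ≤ (n + 1) ^ (n + 1) := by
    push_cast
    exact pow_le_pow_right₀ (by linarith [(n.cast_nonneg : (0 : ℝ) ≤ n)]) hj
  calc ((j : ℝ) + 1) ^ 2 * ((n + 1 : ℕ) : ℝ) ^ (j + 1) * δ ^ 2 * minorSq (twistMat n Q x * realMat T)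
      ≤ ((n : ℝ) + 1) ^ 2 * (n + 1) ^ (n + 1) * δ ^ 2 * 1 := by
        gcongr
        exact minorSq_nonneg _
    _ = _ := mul_one _

/-- Quantitative nondivergence for the Veronese curve: outside a set of small relative measure, no
nonzero integer vector is short under `twistMat n Q x`. -/
lemma exists_volume_short_vector_le (n : ℕ) {η : ℝ} (hη : 0 < η) :
    ∃ δ : ℝ, 0 < δ ∧ δ ≤ 1 ∧ ∀ x r : ℝ, 0 < r → ∃ Q₀ : ℝ, 1 ≤ Q₀ ∧ ∀ Q : ℝ, Q₀ ≤ Q →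
      volume {z ∈ Metric.closedBall x r | ∃ v : Fin (n + 1) → ℤ, v ≠ 0 ∧
        ∀ i, |(twistMat n Q z).mulVec (realVec v) i| ≤ δ} ≤ ENNReal.ofReal (η * r) := by
  classical
  obtain ⟨ε, hε, -, H⟩ := exists_volume_not_isMarked_le (n + 1) (2 * ((n + 1) * n)) hη
  set K : ℝ := (n + 1) ^ 2 * (n + 1) ^ (n + 1) with hK
  have hKpos : 0 < K := by positivity
  refine ⟨min 1 (ε / (2 * K)), by positivity, min_le_left _ _, ?_⟩
  set δ := min 1 (ε / (2 * K)) with hδ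
  have hδpos : 0 < δ := by positivity
  have hδ1 : δ ≤ 1 := min_le_left _ _
  have hKδ : K * δ ^ 2 < ε := by
    have h1 : δ ≤ ε / (2 * K) := min_le_right _ _
    calc K * δ ^ 2 ≤ K * δ := by
          gcongr
          nlinarith
      _ ≤ K * (ε / (2 * K)) := by gcongr
      _ = ε / 2 := by field_simp
      _ < ε := by linarith
  intro x r hr
  obtain ⟨Q₀, hQ₀, HQ⟩ := exists_one_le_covolX n x hr
  refine ⟨Q₀, hQ₀, fun Q hQ => ?_⟩
  have hQ1 : 1 ≤ Q := hQ₀.trans hQ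
  set M : ℕ := ⌈1 + Q + ∑ l : Fin n, Q * (|x| + r) ^ ((l : ℕ) + 1)⌉₊ with hM
  have hMle : 1 + Q + ∑ l : Fin n, Q * (|x| + r) ^ ((l : ℕ) + 1) ≤ M := Nat.le_ceil _
  set F : Finset (Fin (n + 1) → ℤ) := Fintype.piFinset fun _ => Finset.Icc (-(M : ℤ)) M with hF
  set P : Finset (Submodule ℝ (Fin (n + 1) → ℝ)) :=
    (F.powerset.image fun s : Finset (Fin (n + 1) → ℤ) =>
      Submodule.span ℝ (realVec '' (s : Set (Fin (n + 1) → ℤ)))).filter (· ≠ ⊥) with hPdef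
  have hP : ∀ W, W ∈ P ↔ W ≠ ⊥ ∧ ∃ s ⊆ F, Submodule.span ℝ (realVec '' (s : Set _)) = W := by
    intro W
    simp only [hPdef, Finset.mem_filter, Finset.mem_image, Finset.mem_powerset]
    exact and_comm
  have hex : ∀ W, ∃ p : Polynomial ℝ, W ∈ P → ∃ (j : ℕ) (T : Fin j → Fin (n + 1) → ℤ),
      IsIntBasis T W ∧ p = covolX n Q T ∧
      ∀ (j' : ℕ) (T' : Fin j' → Fin (n + 1) → ℤ), IsIntBasis T' W →
        ∀ A : Matrix (Fin (n + 1)) (Fin (n + 1)) ℝ,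
          minorSq (A * realMat T) ≤ minorSq (A * realMat T') := by
    intro W
    by_cases hW : W ∈ P
    · obtain ⟨-, s, -, rfl⟩ := (hP W).1 hW
      obtain ⟨j, T, hT, hmin⟩ := exists_isIntBasis_minimal
        (exists_isIntBasis_span (s : Set (Fin (n + 1) → ℤ)))
      exact ⟨covolX n Q T, fun _ => ⟨j, T, hT, rfl, hmin⟩⟩
    · exact ⟨0, fun h => absurd h hW⟩
  choose f hf using hex
  refine le_trans (measure_mono ?_) (H P f ?_ ?_ x r hr ?_)
  · rintro z ⟨hz, v, hv0, hv⟩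
    refine ⟨hz, fun hmark => ?_⟩
    refine absurd (le_of_isMarked hP hf hmark ?_ hv0 hv) (not_le.2 hKδ)
    have hzb : |z| ≤ |x| + r := by
      rw [Metric.mem_closedBall, Real.dist_eq] at hz
      have := abs_add_le x (z - x)
      rw [add_sub_cancel] at this
      linarith
    have hsucc : ∀ l : Fin n, |(v l.succ : ℝ)| ≤ Q := by
      intro l
      have := hv l.succ
      rw [twistMat_mulVec_of_ne_zero _ _ _ _ (Fin.succ_ne_zero l), abs_div,
        abs_of_nonneg (by linarith : (0 : ℝ) ≤ Q), div_le_iff₀ (by linarith)] at this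
      calc |(v l.succ : ℝ)| ≤ δ * Q := this
        _ ≤ 1 * Q := by gcongr
        _ = Q := one_mul _
    have hsum0 : 0 ≤ ∑ l : Fin n, Q * (|x| + r) ^ ((l : ℕ) + 1) := by positivity
    have hzero : |(v 0 : ℝ)| ≤ M := by
      have h0 := hv 0
      rw [twistMat_mulVec_zero, abs_mul, abs_of_nonneg (by positivity), Fin.sum_univ_succ] at h0
      simp only [Fin.val_zero, pow_zero, mul_one, Fin.val_succ, realVec] at h0
      set y := ∑ l : Fin n, (v l.succ : ℝ) * z ^ ((l : ℕ) + 1) with hy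
      have h1 : |(v 0 : ℝ) + y| ≤ 1 := by
        calc |(v 0 : ℝ) + y| ≤ Q ^ n * |(v 0 : ℝ) + y| :=
              le_mul_of_one_le_left (abs_nonneg _) (one_le_pow₀ hQ1)
          _ ≤ δ := h0
          _ ≤ 1 := hδ1
      have h2 : |y| ≤ ∑ l : Fin n, Q * (|x| + r) ^ ((l : ℕ) + 1) := by
        refine (Finset.abs_sum_le_sum_abs _ _).trans (Finset.sum_le_sum fun l _ => ?_)
        rw [abs_mul, abs_pow]
        have := hsucc l
        gcongr
      have h3 : |(v 0 : ℝ)| ≤ |(v 0 : ℝ) + y| + |y| := by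
        have := abs_sub ((v 0 : ℝ) + y) y
        rwa [add_sub_cancel_right] at this
      linarith
    rw [hF, Fintype.mem_piFinset]
    intro i
    rw [Finset.mem_Icc, ← abs_le]
    have : |(v i : ℝ)| ≤ M := by
      refine Fin.cases hzero (fun l => ?_) i
      linarith [hsucc l]
    exact_mod_cast this
  · intro W hW
    obtain ⟨j, T, hT, hfT, -⟩ := hf W hW
    rw [hfT]
    refine (natDegree_covolX_le _ _ _).trans ?_
    have hj : j ≤ n + 1 := by
      have := hT.1.fintype_card_le_finrank
      simpa using this
    gcongr
  · intro S hS hch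
    exact card_le_of_isChain_submodule S hch fun W hW => ((hP W).1 (hS hW)).1
  · intro W hW
    obtain ⟨j, T, hT, hfT, -⟩ := hf W hW
    rw [hfT]
    refine HQ Q hQ j T (Nat.pos_of_ne_zero ?_) hT.1
    rintro rfl
    refine ((hP W).1 hW).1 ?_
    rw [← hT.2, Set.range_eq_empty, Submodule.span_empty]

lemma infDist_add_le_of_mem {E : Type*} [SeminormedAddCommGroup E] (L : AddSubgroup E) {v : E}
    (hv : v ∈ L) (p : E) : Metric.infDist (v + p) L ≤ Metric.infDist p L := by
  refine (Metric.le_infDist ⟨0, L.zero_mem⟩).2 fun y hy => ?_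
  rw [← dist_add_left v p y]
  exact Metric.infDist_le_dist_of_mem (L.add_mem hv hy)

lemma infDist_add_of_mem {E : Type*} [SeminormedAddCommGroup E] (L : AddSubgroup E) {v : E}
    (hv : v ∈ L) (p : E) : Metric.infDist (v + p) L = Metric.infDist p L := by
  refine le_antisymm (infDist_add_le_of_mem L hv p) ?_
  simpa using infDist_add_le_of_mem L (L.neg_mem hv) (v + p)

/-- A lattice in `ℝᵐ` without short vectors whose fundamental parallelepiped has small volume has a
bounded covering radius. -/
lemma infDist_lattice_lt {m : ℕ} (b : Module.Basis (Fin m) ℝ (Fin m → ℝ)) {δ : ℝ} (hδ : 0 < δ)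
    (hb : ∀ v ∈ Submodule.span ℤ (Set.range b), v ≠ 0 → δ ≤ ‖v‖) {K : ℕ}
    (hK : |(Matrix.of b).det| < (K + 1) * δ ^ m) (y : Fin m → ℝ) :
    Metric.infDist y (Submodule.span ℤ (Set.range b)) < K * δ := by
  by_contra! hy
  set L := (Submodule.span ℤ (Set.range b)).toAddSubgroup with hL
  have h0 : Metric.infDist (0 : Fin m → ℝ) L = 0 := Metric.infDist_zero_of_mem L.zero_mem
  have hpt : ∀ k : Fin (K + 1), ∃ z : Fin m → ℝ, Metric.infDist z L = k * δ := by
    intro k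
    have hcont : ContinuousOn (fun t : ℝ => Metric.infDist (t • y) L) (Set.Icc 0 1) :=
      (Metric.continuous_infDist_pt _ |>.comp (by fun_prop)).continuousOn
    have hk : (k : ℝ) ≤ K := by exact_mod_cast Nat.le_of_lt_succ k.2
    obtain ⟨t, -, ht⟩ := intermediate_value_Icc zero_le_one hcont
      (show (k : ℝ) * δ ∈ _ by
        simp only [zero_smul, one_smul, h0]
        exact ⟨by positivity, (by gcongr : (k : ℝ) * δ ≤ K * δ).trans hy⟩)
    exact ⟨_, ht⟩
  choose z hz using hpt
  have hclose : ∀ k, ∀ p ∈ Metric.ball (z k) (δ / 2), |Metric.infDist p L - k * δ| < δ / 2 := by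
    intro k p hp
    rw [← hz k, ← Real.dist_eq]
    refine lt_of_le_of_lt ?_ hp
    simpa using (Metric.lipschitz_infDist_pt (L : Set (Fin m → ℝ))).dist_le_mul p (z k)
  have hkl : ∀ k l : Fin (K + 1), ∀ p ∈ Metric.ball (z k) (δ / 2),
      ∀ q ∈ Metric.ball (z l) (δ / 2), Metric.infDist p L = Metric.infDist q L → k = l := by
    intro k l p hp q hq hpq
    have h1 := abs_lt.1 (hclose k p hp)
    have h2 := abs_lt.1 (hclose l q hq)
    rw [hpq] at h1
    have h3 : (k : ℝ) < l + 1 := by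
      refine lt_of_mul_lt_mul_right ?_ hδ.le
      linarith
    have h4 : (l : ℝ) < k + 1 := by
      refine lt_of_mul_lt_mul_right ?_ hδ.le
      linarith
    have h5 : (k : ℕ) < l + 1 := by exact_mod_cast h3
    have h6 : (l : ℕ) < k + 1 := by exact_mod_cast h4
    exact Fin.ext (by omega)
  have hvol : volume (⋃ k, Metric.ball (z k) (δ / 2)) = ENNReal.ofReal ((K + 1) * δ ^ m) := by
    rw [measure_iUnion _ fun k => measurableSet_ball]
    · simp_rw [Real.volume_pi_ball _ (half_pos hδ), mul_div_cancel₀ δ two_ne_zero]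
      rw [tsum_fintype, Finset.sum_const, Finset.card_univ, Fintype.card_fin, Fintype.card_fin,
        nsmul_eq_mul, ENNReal.ofReal_mul (by positivity)]
      congr 1
      rw [← Nat.cast_add_one, ENNReal.ofReal_natCast]
    · intro k l hne
      refine Set.disjoint_left.2 fun p hp hq => hne (hkl k l p hp p hq rfl)
  have : Countable L := inferInstanceAs (Countable (Submodule.span ℤ (Set.range b)))
  obtain ⟨u, w, huw, hdis⟩ := exists_pair_mem_lattice_not_disjoint_vadd
    (ZSpan.isAddFundamentalDomain' b volume)
    (MeasurableSet.iUnion fun k => measurableSet_ball (x := z k) (ε := δ / 2)).nullMeasurableSet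
    (by
      rw [ZSpan.volume_fundamentalDomain, hvol]
      exact (ENNReal.ofReal_lt_ofReal_iff (lt_of_le_of_lt (abs_nonneg _) hK)).2 hK)
  obtain ⟨_, ⟨p, hp, rfl⟩, ⟨q, hq, hpq⟩⟩ := Set.not_disjoint_iff.1 hdis
  obtain ⟨k, hk⟩ := Set.mem_iUnion.1 hp
  obtain ⟨l, hl⟩ := Set.mem_iUnion.1 hq
  have hpq' : (w : Fin m → ℝ) + q = u + p := hpq
  have hinf : Metric.infDist p L = Metric.infDist q L := by
    rw [← infDist_add_of_mem L u.2 p, ← hpq', infDist_add_of_mem L w.2 q]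
  obtain rfl := hkl k l p hk q hl hinf
  have h1 := hb (u - w) (Submodule.sub_mem _ u.2 w.2) (by
    rw [sub_ne_zero]
    exact fun h => huw (Subtype.ext h))
  have h2 : (u : Fin m → ℝ) - w = q - p := by
    rw [sub_eq_sub_iff_add_eq_add, ← hpq', add_comm]
  rw [h2, ← dist_eq_norm] at h1
  have h3 := dist_triangle_right q p (z k)
  rw [Metric.mem_ball] at hk hl
  linarith

/-- Every point is within bounded distance of the lattice generated by the columns of a unimodular
real matrix, provided this lattice has no short vectors. -/
lemma exists_abs_mulVec_sub_le (m : ℕ) {δ : ℝ} (hδ : 0 < δ) :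
    ∃ R : ℝ, 0 < R ∧ ∀ A : Matrix (Fin m) (Fin m) ℝ, A.det = 1 →
      (∀ v : Fin m → ℤ, v ≠ 0 → ∃ i, δ < |A.mulVec (realVec v) i|) →
      ∀ y : Fin m → ℝ, ∃ v : Fin m → ℤ, ∀ i, |A.mulVec (realVec v) i - y i| ≤ R := by
  classical
  obtain ⟨K, hK⟩ := exists_nat_gt (1 / δ ^ m)
  refine ⟨(K + 1) * δ, by positivity, fun A hA hshort y => ?_⟩
  have hli : LinearIndependent ℝ A.col :=
    Matrix.linearIndependent_cols_iff_isUnit.2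
      ((Matrix.isUnit_iff_isUnit_det A).2 (hA ▸ isUnit_one))
  set b := basisOfPiSpaceOfLinearIndependent hli with hb
  have hbcol : (b : Fin m → Fin m → ℝ) = A.col := coe_basisOfPiSpaceOfLinearIndependent hli
  have hcol : ∀ c : Fin m → ℤ, ∑ i, c i • b i = A.mulVec (realVec c) := by
    intro c
    ext j
    simp [hbcol, Matrix.mulVec, dotProduct, realVec, mul_comm]
  have hlt := infDist_lattice_lt b hδ (K := K) ?_ ?_ y
  · obtain ⟨p, hp, hyp⟩ := (Metric.infDist_lt_iff ⟨0, Submodule.zero_mem _⟩).1 hlt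
    obtain ⟨c, rfl⟩ := (Submodule.mem_span_range_iff_exists_fun ℤ).1 hp
    refine ⟨c, fun i => ?_⟩
    rw [← hcol, ← Real.dist_eq, dist_comm]
    refine (dist_le_pi_dist _ _ i).trans (hyp.le.trans ?_)
    gcongr
    linarith
  · intro v hv hv0
    obtain ⟨c, rfl⟩ := (Submodule.mem_span_range_iff_exists_fun ℤ).1 hv
    obtain ⟨i, hi⟩ := hshort c (by rintro rfl; simp at hv0)
    rw [hcol]
    exact hi.le.trans (norm_le_pi_norm (A.mulVec (realVec c)) i)
  · have : Matrix.of b = A.transpose := by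
      rw [hbcol]
      rfl
    rw [this, Matrix.det_transpose, hA, abs_one]
    rw [div_lt_iff₀ (by positivity)] at hK
    nlinarith [pow_pos hδ m]

lemma natDegree_le_of_irreducible_of_aeval_eq_zero {α : ℝ} {P Q : Polynomial ℤ}
    (hprim : P.IsPrimitive) (hP : Irreducible P) (hα : Polynomial.aeval α P = 0) (hQ : Q ≠ 0)
    (hQα : Polynomial.aeval α Q = 0) : P.natDegree ≤ Q.natDegree := by
  have hinj : Function.Injective (Int.castRingHom ℚ) := Int.cast_injective
  have hirr := (Polynomial.IsPrimitive.Int.irreducible_iff_irreducible_map_cast hprim).1 hP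
  have hcast : ∀ F : Polynomial ℤ, Polynomial.aeval α F = 0 →
      Polynomial.aeval α (F.map (Int.castRingHom ℚ)) = 0 := by
    intro F hF
    rw [← hF]
    exact Polynomial.aeval_map_algebraMap ℚ α F
  have hmin := minpoly.eq_of_irreducible hirr (hcast P hα)
  have hdvd := minpoly.dvd ℚ α (hcast Q hQα)
  rw [← hmin] at hdvd
  have := Polynomial.natDegree_le_of_dvd (dvd_of_mul_right_dvd hdvd)
    ((Polynomial.map_ne_zero_iff hinj).2 hQ)
  rwa [Polynomial.natDegree_map_eq_of_injective hinj,
    Polynomial.natDegree_map_eq_of_injective hinj] at this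

lemma exists_isMinIntPoly_of_eisenstein {n : ℕ} (hn : 0 < n) {P : Polynomial ℤ}
    (hdeg : P.natDegree = n) (hlead : ¬ 2 ∣ P.coeff n) (hdvd : ∀ i < n, 2 ∣ P.coeff i)
    (hzero : ¬ 4 ∣ P.coeff 0) {α : ℝ} (hα : Polynomial.aeval α P = 0) :
    ∃ P₁ : Polynomial ℤ, IsMinIntPoly α P₁ ∧ P₁.natDegree = n ∧
      ∀ i, |P₁.coeff i| ≤ |P.coeff i| := by
  have hP0 : P ≠ 0 := by
    rintro rfl
    simp at hlead
  set p := P.primPart with hp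
  have hpdeg : p.natDegree = n := by rw [hp, Polynomial.natDegree_primPart, hdeg]
  have hp0 : p ≠ 0 := Polynomial.primPart_ne_zero P
  have hcoeff : ∀ i, P.coeff i = P.content * p.coeff i := by
    intro i
    conv_lhs => rw [P.eq_C_content_mul_primPart, Polynomial.coeff_C_mul]
  have hc2 : ¬ 2 ∣ P.content := fun h => hlead (by rw [hcoeff]; exact h.mul_right _)
  have hprim : p.IsPrimitive := P.isPrimitive_primPart
  have hpα : Polynomial.aeval α p = 0 := Polynomial.aeval_primPart_eq_zero hP0 hα
  have hirr : Irreducible p := by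
    refine Polynomial.irreducible_of_eisenstein_criterion (P := Ideal.span {2})
      ((Ideal.span_singleton_prime two_ne_zero).2 Int.prime_two) ?_ ?_ ?_ ?_ hprim
    · rw [Ideal.mem_span_singleton, Polynomial.leadingCoeff, hpdeg]
      exact fun h => hlead (by rw [hcoeff]; exact h.mul_left _)
    · intro i hi
      rw [Polynomial.degree_eq_natDegree hp0, hpdeg, Nat.cast_lt] at hi
      have := hdvd i hi
      rw [hcoeff] at this
      exact Ideal.mem_span_singleton.2 ((Int.prime_two.dvd_or_dvd this).resolve_left hc2)
    · rw [Polynomial.degree_eq_natDegree hp0, hpdeg]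
      exact_mod_cast hn
    · rw [Ideal.span_singleton_pow, Ideal.mem_span_singleton]
      exact fun h => hzero (by rw [hcoeff]; exact Dvd.dvd.mul_left (by simpa using h) _)
  have hle : ∀ i, |p.coeff i| ≤ |P.coeff i| := by
    intro i
    rw [hcoeff, abs_mul]
    refine le_mul_of_one_le_left (abs_nonneg _) (Int.one_le_abs ?_)
    rw [Ne, Polynomial.content_eq_zero_iff]
    exact hP0
  have hmin : ∀ Q : Polynomial ℤ, Q ≠ 0 → Polynomial.aeval α Q = 0 → p.natDegree ≤ Q.natDegree :=
    fun Q hQ hQα => natDegree_le_of_irreducible_of_aeval_eq_zero hprim hirr hpα hQ hQα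
  rcases lt_or_gt_of_ne (Polynomial.leadingCoeff_ne_zero.2 hp0) with h | h
  · refine ⟨-p, ⟨neg_ne_zero.2 hp0, ?_, ?_, ?_, ?_⟩, ?_, ?_⟩
    · rw [Polynomial.leadingCoeff_neg]
      linarith
    · have : -p = Polynomial.C (-1) * p := by simp
      rw [this, Polynomial.content_C_mul, hprim.content_eq_one]
      rfl
    · rw [map_neg, hpα, neg_zero]
    · simpa using hmin
    · rw [Polynomial.natDegree_neg, hpdeg]
    · simpa using hle
  · exact ⟨p, ⟨hp0, h, hprim.content_eq_one, hpα, hmin⟩, hpdeg, hle⟩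

lemma intPolyHeight_le {P : Polynomial ℤ} {B : ℝ} (hB : 0 ≤ B) (h : ∀ i, (|P.coeff i| : ℝ) ≤ B) :
    (intPolyHeight P : ℝ) ≤ B := by
  rw [← Nat.le_floor_iff hB]
  refine Finset.sup_le fun i _ => ?_
  rw [Nat.le_floor_iff hB, Nat.cast_natAbs, Int.cast_abs]
  exact h i

/-- A function with derivative at least `c > 0` near a point where it is at most `c * h` in absolute
value vanishes within distance `h` of that point. -/
lemma exists_eq_zero_of_le_deriv {f f' : ℝ → ℝ} {x c h : ℝ} (hh : 0 ≤ h)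
    (hf : ∀ y, HasDerivAt f (f' y) y) (hc : ∀ y, |x - y| ≤ h → c ≤ f' y) (hx : |f x| ≤ c * h) :
    ∃ α, |x - α| ≤ h ∧ f α = 0 := by
  have hcont : Continuous f := continuous_iff_continuousAt.2 fun y => (hf y).continuousAt
  have hmono := (convex_Icc (x - h) (x + h)).mul_sub_le_image_sub_of_le_deriv (f := f) (C := c)
    hcont.continuousOn (fun y _ => (hf y).differentiableAt.differentiableWithinAt)
    (fun y hy => by
      rw [(hf y).deriv]
      have := interior_subset hy
      exact hc y (abs_le.2 ⟨by linarith [this.2], by linarith [this.1]⟩))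
  have h1 := hmono (x - h) ⟨le_rfl, by linarith⟩ x ⟨by linarith, by linarith⟩ (by linarith)
  have h2 := hmono x ⟨by linarith, by linarith⟩ (x + h) ⟨by linarith, le_rfl⟩ (by linarith)
  obtain ⟨h3, h4⟩ := abs_le.1 hx
  obtain ⟨α, hα, hfα⟩ := intermediate_value_Icc (by linarith : x - h ≤ x + h) hcont.continuousOn
    (show (0 : ℝ) ∈ Set.Icc (f (x - h)) (f (x + h)) from ⟨by linarith, by linarith⟩)
  exact ⟨α, abs_le.2 ⟨by linarith [hα.2], by linarith [hα.1]⟩, hfα⟩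

/-- Inhomogeneous approximation by integer vectors in a prescribed residue class modulo `4`. -/
lemma exists_abs_mulVec_sub_le_of_modEq {m : ℕ} {R : ℝ} {A : Matrix (Fin m) (Fin m) ℝ}
    (hA : ∀ y : Fin m → ℝ, ∃ v : Fin m → ℤ, ∀ i, |A.mulVec (realVec v) i - y i| ≤ R)
    (e : Fin m → ℤ) (t : Fin m → ℝ) :
    ∃ v : Fin m → ℤ, (∀ i, (4 : ℤ) ∣ v i - e i) ∧ ∀ i, |A.mulVec (realVec v) i - t i| ≤ 4 * R := by
  obtain ⟨z, hz⟩ := hA fun i => (t i - A.mulVec (realVec e) i) / 4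
  refine ⟨fun i => 4 * z i + e i, fun i => ⟨z i, by ring⟩, fun i => ?_⟩
  have hv : realVec (fun i => 4 * z i + e i) = (4 : ℝ) • realVec z + realVec e := by
    ext i
    simp [realVec]
  rw [hv, Matrix.mulVec_add, Matrix.mulVec_smul, Pi.add_apply, Pi.smul_apply, smul_eq_mul]
  have := hz i
  calc |4 * A.mulVec (realVec z) i + A.mulVec (realVec e) i - t i|
      = |4 * (A.mulVec (realVec z) i - (t i - A.mulVec (realVec e) i) / 4)| := by
        congr 1
        ring
    _ = 4 * |A.mulVec (realVec z) i - (t i - A.mulVec (realVec e) i) / 4| := by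
        rw [abs_mul, abs_of_pos (four_pos : (0 : ℝ) < 4)]
    _ ≤ 4 * R := by gcongr

/-- If `twistMat n Q x` takes no nonzero integer vector to a short one, then there is an algebraic
number of degree exactly `n` and height `O(Q)` within `Q ^ (-(n + 1))` of `x`. -/
lemma exists_isMinIntPoly_near {n : ℕ} (hn : 0 < n) (X : ℝ) {δ : ℝ} (hδ : 0 < δ) :
    ∃ C : ℝ, 0 < C ∧ ∀ Q : ℝ, 1 ≤ Q → ∀ x : ℝ, |x| ≤ X →
      (∀ v : Fin (n + 1) → ℤ, v ≠ 0 → ∃ i, δ < |(twistMat n Q x).mulVec (realVec v) i|) →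
      ∃ (α : ℝ) (P : Polynomial ℤ), IsMinIntPoly α P ∧ P.natDegree = n ∧
        (intPolyHeight P : ℝ) ≤ C * Q ∧ |x - α| ≤ 1 / Q ^ (n + 1) := by
  classical
  obtain ⟨m, rfl⟩ : ∃ m, n = m + 1 := ⟨n - 1, by omega⟩
  obtain ⟨R, hR, HR⟩ := exists_abs_mulVec_sub_le (m + 1 + 1) hδ
  rcases lt_or_ge X 0 with hX | hX
  · exact ⟨1, one_pos, fun Q _ x hx => absurd (abs_nonneg x) (by linarith)⟩
  set S : ℝ := ∑ l : Fin m, ((l : ℝ) + 2) * (X + 1) ^ ((l : ℕ) + 1) with hS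
  set S' : ℝ := ∑ l : Fin (m + 1), X ^ ((l : ℕ) + 1) with hS'
  have hS0 : 0 ≤ S := by positivity
  have hS'0 : 0 ≤ S' := by positivity
  set L : ℝ := 8 * R + 4 * R * S with hL
  have hL0 : 0 < L := by positivity
  refine ⟨(L + 4 * R) * (1 + S'), by positivity, fun Q hQ x hx hshort => ?_⟩
  have hQ0 : 0 < Q := by linarith
  obtain ⟨v, hve, hvt⟩ := exists_abs_mulVec_sub_le_of_modEq (HR _ (det_twistMat _ hQ0 x) hshort)
    (fun i => if i = 0 then 2 else if i = Fin.last _ then 1 else 0)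
    (fun i => if i = 1 then L else 0)
  have h10 : (1 : Fin (m + 1 + 1)) ≠ 0 := by simp
  have hlast : Fin.last (m + 1) ≠ 0 := by simp
  set f : ℝ → ℝ := fun y => ∑ l, (v l : ℝ) * y ^ (l : ℕ) with hf
  set f' : ℝ → ℝ := fun y => ∑ l, (v l : ℝ) * ((l : ℕ) * y ^ ((l : ℕ) - 1)) with hf'
  have hderiv : ∀ y, HasDerivAt f (f' y) y := fun y =>
    HasDerivAt.fun_sum fun l _ => (hasDerivAt_pow (l : ℕ) y).const_mul _
  have hfx : Q ^ (m + 1) * |f x| ≤ 4 * R := by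
    have := hvt 0
    rw [twistMat_mulVec_zero, if_neg h10.symm, sub_zero, abs_mul, abs_of_pos (by positivity)] at this
    exact this
  have hv1 : |(v 1 : ℝ) - L * Q| ≤ 4 * R * Q := by
    have := hvt 1
    rw [twistMat_mulVec_of_ne_zero _ _ _ _ h10, if_pos rfl] at this
    have h2 : (v 1 : ℝ) - L * Q = (realVec v 1 / Q - L) * Q := by
      rw [sub_mul, div_mul_cancel₀ _ hQ0.ne']
      rfl
    rw [h2, abs_mul, abs_of_pos hQ0]
    gcongr
  have hv2 : ∀ l : Fin m, |(v l.succ.succ : ℝ)| ≤ 4 * R * Q := by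
    intro l
    have := hvt l.succ.succ
    have h1 : l.succ.succ ≠ 1 := by
      rw [← Fin.succ_zero_eq_one, Ne, Fin.succ_inj]
      exact Fin.succ_ne_zero l
    rw [twistMat_mulVec_of_ne_zero _ _ _ _ (Fin.succ_ne_zero _), if_neg h1, sub_zero, abs_div,
      abs_of_pos hQ0, div_le_iff₀ hQ0] at this
    exact this
  have hvs : ∀ l : Fin (m + 1), |(v l.succ : ℝ)| ≤ (L + 4 * R) * Q := by
    refine Fin.cases ?_ fun l => ?_
    · rw [Fin.succ_zero_eq_one]
      have := abs_sub_abs_le_abs_sub (v 1 : ℝ) (L * Q)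
      rw [abs_of_pos (by positivity : 0 < L * Q)] at this
      linarith
    · have := hv2 l
      nlinarith
  have hlow : ∀ y, |x - y| ≤ 1 / Q ^ (m + 1 + 1) → 4 * R * Q ≤ f' y := by
    intro y hy
    have hy1 : |y| ≤ X + 1 := by
      have h1 : 1 / Q ^ (m + 1 + 1) ≤ 1 := by
        rw [div_le_one (by positivity)]
        exact one_le_pow₀ hQ
      have := abs_sub_abs_le_abs_sub y x
      rw [abs_sub_comm] at this
      linarith
    have hsum : |∑ l : Fin m, (v l.succ.succ : ℝ) * (((l : ℝ) + 2) * y ^ ((l : ℕ) + 1))| ≤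
        4 * R * Q * S := by
      rw [hS, Finset.mul_sum]
      refine (Finset.abs_sum_le_sum_abs _ _).trans (Finset.sum_le_sum fun l _ => ?_)
      rw [abs_mul, abs_mul, abs_pow, abs_of_nonneg (by positivity : (0 : ℝ) ≤ l + 2)]
      have := hv2 l
      gcongr
    have hf'y : f' y = v 1 + ∑ l : Fin m, (v l.succ.succ : ℝ) * (((l : ℝ) + 2) * y ^ ((l : ℕ) + 1)) := by
      simp only [hf']
      rw [Fin.sum_univ_succ, Fin.sum_univ_succ, Fin.val_zero, Nat.cast_zero, zero_mul, mul_zero,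
        zero_add]
      refine congrArg₂ (· + ·) ?_ (Finset.sum_congr rfl fun l _ => ?_)
      · simp
      · simp only [Fin.val_succ, Nat.add_sub_cancel]
        push_cast
        ring
    rw [hf'y]
    have h1 := (abs_le.1 hsum).1
    have h2 := (abs_le.1 hv1).1
    rw [hL] at h2
    linarith
  obtain ⟨α, hα, hfα⟩ := exists_eq_zero_of_le_deriv (by positivity) hderiv hlow (by
    rw [mul_one_div, le_div_iff₀ (by positivity)]
    calc |f x| * Q ^ (m + 1 + 1) = Q ^ (m + 1) * |f x| * Q := by ring
      _ ≤ 4 * R * Q := by gcongr)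
  set P : Polynomial ℤ := Polynomial.ofFn (m + 1 + 1) v with hP
  have hcoeff : ∀ (i : ℕ) (hi : i < m + 1 + 1), P.coeff i = v ⟨i, hi⟩ := fun i hi =>
    Polynomial.ofFn_coeff_eq_val_of_lt v hi
  have hPlt : P.natDegree < m + 1 + 1 := Polynomial.ofFn_natDegree_lt (by omega) v
  have hvlast : ¬ 2 ∣ P.coeff (m + 1) := by
    rw [hcoeff _ (Nat.lt_succ_self _)]
    have := hve (Fin.last _)
    rw [if_neg hlast, if_pos rfl] at this
    change ¬ 2 ∣ v (Fin.last (m + 1))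
    omega
  have hPα : Polynomial.aeval α P = 0 := by
    rw [Polynomial.aeval_eq_sum_range' hPlt, Finset.sum_range, ← hfα]
    refine Finset.sum_congr rfl fun l _ => ?_
    rw [hcoeff l l.2, zsmul_eq_mul]
  have hdvd : ∀ i < m + 1, 2 ∣ P.coeff i := by
    intro i hi
    rw [hcoeff i (by omega)]
    have := hve ⟨i, by omega⟩
    split_ifs at this with h1 h2
    · omega
    · rw [Fin.ext_iff] at h2
      simp at h2
      omega
    · omega
  have hzero : ¬ 4 ∣ P.coeff 0 := by
    rw [hcoeff 0 (by omega)]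
    have := hve 0
    rw [if_pos rfl] at this
    change ¬ 4 ∣ v 0
    omega
  obtain ⟨P₁, hP₁, hdeg, hle⟩ := exists_isMinIntPoly_of_eisenstein (n := m + 1) (by omega)
    (le_antisymm (by omega) (Polynomial.le_natDegree_of_ne_zero fun h => hvlast (by simp [h])))
    hvlast hdvd hzero hPα
  refine ⟨α, P₁, hP₁, hdeg, intPolyHeight_le (by positivity) fun i => ?_, hα⟩
  have h1 : (|P₁.coeff i| : ℝ) ≤ |(P.coeff i : ℝ)| := by exact_mod_cast hle i
  refine h1.trans ?_
  rcases lt_or_ge i (m + 1 + 1) with hi | hi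
  · rw [hcoeff i hi]
    have hv0 : |(v 0 : ℝ)| ≤ (L + 4 * R) * (1 + S') * Q := by
      have hfx0 : f x = v 0 + ∑ l : Fin (m + 1), (v l.succ : ℝ) * x ^ ((l : ℕ) + 1) := by
        rw [hf]
        simp only [Fin.sum_univ_succ (n := m + 1)]
        simp
      have hsum : |∑ l : Fin (m + 1), (v l.succ : ℝ) * x ^ ((l : ℕ) + 1)| ≤
          (L + 4 * R) * Q * S' := by
        rw [hS', Finset.mul_sum]
        refine (Finset.abs_sum_le_sum_abs _ _).trans (Finset.sum_le_sum fun l _ => ?_)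
        rw [abs_mul, abs_pow]
        have := hvs l
        gcongr
      have hfx1 : |f x| ≤ 4 * R * Q := by
        calc |f x| ≤ Q ^ (m + 1) * |f x| :=
              le_mul_of_one_le_left (abs_nonneg _) (one_le_pow₀ hQ)
          _ ≤ 4 * R := hfx
          _ ≤ 4 * R * Q := le_mul_of_one_le_right (by positivity) hQ
      have h3 := abs_sub (f x) (∑ l : Fin (m + 1), (v l.succ : ℝ) * x ^ ((l : ℕ) + 1))
      rw [hfx0, add_sub_cancel_right, ← hfx0] at h3
      nlinarith
    have hall : ∀ l : Fin (m + 1 + 1), |(v l : ℝ)| ≤ (L + 4 * R) * (1 + S') * Q := by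
      refine Fin.cases hv0 fun l => (hvs l).trans ?_
      have : 0 ≤ (L + 4 * R) * S' * Q := by positivity
      linarith
    exact hall _
  · rw [Polynomial.coeff_eq_zero_of_natDegree_lt (by omega)]
    simp only [Int.cast_zero, abs_zero]
    positivity

/-- The second moment bound for the measure of a finite union. -/
lemma sq_sum_measureReal_le {α ι : Type*} [MeasurableSpace α] (μ : Measure α) (I : Finset ι)
    {E : ι → Set α} (hE : ∀ i, MeasurableSet (E i)) (hfin : ∀ i, μ (E i) ≠ ⊤) :
    (∑ i ∈ I, μ.real (E i)) ^ 2 ≤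
      (∑ i ∈ I, ∑ j ∈ I, μ.real (E i ∩ E j)) * μ.real (⋃ i ∈ I, E i) := by
  set U := ⋃ i ∈ I, E i with hU
  have hUm : MeasurableSet U := I.measurableSet_biUnion fun i _ => hE i
  have hUfin : μ U ≠ ⊤ := (measure_biUnion_lt_top I.finite_toSet fun i _ => (hfin i).lt_top).ne
  have hInt : ∀ {s : Set α}, MeasurableSet s → μ s ≠ ⊤ →
      Integrable (s.indicator (1 : α → ℝ)) μ := fun hs h =>
    (integrable_indicator_iff hs).2 (integrableOn_const h)
  have hintE : ∀ i, Integrable ((E i).indicator (1 : α → ℝ)) μ := fun i => hInt (hE i) (hfin i)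
  have hintEE : ∀ i j, Integrable ((E i ∩ E j).indicator (1 : α → ℝ)) μ := fun i j =>
    hInt ((hE i).inter (hE j)) (measure_inter_ne_top_of_left_ne_top (hfin i))
  have key : ∀ t : ℝ, 0 ≤ (∑ i ∈ I, ∑ j ∈ I, μ.real (E i ∩ E j)) * (t * t) +
      (-2 * ∑ i ∈ I, μ.real (E i)) * t + μ.real U := by
    intro t
    have h : 0 ≤ ∫ x, ((∑ i ∈ I, ∑ j ∈ I, (E i ∩ E j).indicator (1 : α → ℝ) x) * (t * t) +
        (-2 * ∑ i ∈ I, (E i).indicator (1 : α → ℝ) x) * t + U.indicator (1 : α → ℝ) x) ∂μ := by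
      refine integral_nonneg fun x => ?_
      have hsq : ∑ i ∈ I, ∑ j ∈ I, (E i ∩ E j).indicator (1 : α → ℝ) x =
          (∑ i ∈ I, (E i).indicator (1 : α → ℝ) x) ^ 2 := by
        rw [sq, Finset.sum_mul_sum]
        refine Finset.sum_congr rfl fun i _ => Finset.sum_congr rfl fun j _ => ?_
        rw [Set.inter_indicator_one]
        rfl
      simp only [hsq, Pi.zero_apply]
      by_cases hx : x ∈ U
      · rw [Set.indicator_of_mem hx, Pi.one_apply]
        nlinarith [sq_nonneg ((∑ i ∈ I, (E i).indicator (1 : α → ℝ) x) * t - 1)]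
      · have h0 : ∑ i ∈ I, (E i).indicator (1 : α → ℝ) x = 0 :=
          Finset.sum_eq_zero fun i hi => Set.indicator_of_notMem
            (fun hxi => hx (Set.mem_biUnion hi hxi)) _
        rw [h0, Set.indicator_of_notMem hx]
        simp
    have hI1 : Integrable (fun x => ∑ i ∈ I, (E i).indicator (1 : α → ℝ) x) μ :=
      integrable_finsetSum _ fun i _ => hintE i
    have hI2 : Integrable (fun x => ∑ i ∈ I, ∑ j ∈ I, (E i ∩ E j).indicator (1 : α → ℝ) x) μ :=
      integrable_finsetSum _ fun i _ => integrable_finsetSum _ fun j _ => hintEE i j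
    have hI3 : Integrable (fun x =>
        (∑ i ∈ I, ∑ j ∈ I, (E i ∩ E j).indicator (1 : α → ℝ) x) * (t * t) +
          (-2 * ∑ i ∈ I, (E i).indicator (1 : α → ℝ) x) * t) μ :=
      (hI2.mul_const _).add ((hI1.const_mul _).mul_const _)
    rw [integral_add hI3 (hInt hUm hUfin),
      integral_add (hI2.mul_const _) ((hI1.const_mul _).mul_const _), integral_mul_const,
      integral_mul_const, integral_const_mul, integral_finsetSum _ fun i _ => hintE i,
      integral_finsetSum _ fun i _ => integrable_finsetSum _ fun j _ => hintEE i j,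
      integral_indicator_one hUm] at h
    simp_rw [integral_finsetSum I fun j _ => hintEE _ j, integral_indicator_one (hE _),
      integral_indicator_one ((hE _).inter (hE _))] at h
    exact h
  have := discrim_le_zero key
  rw [discrim] at this
  nlinarith

lemma card_le_of_abs_sub_le {G : Finset ℤ} {a w : ℝ} (hw : 0 ≤ w) (hG : ∀ j ∈ G, |(j : ℝ) - a| ≤ w) :
    (G.card : ℝ) ≤ 2 * w + 1 := by
  have hsub : G ⊆ Finset.Icc ⌈a - w⌉ ⌊a + w⌋ := by
    intro j hj
    have := abs_le.1 (hG j hj)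
    exact Finset.mem_Icc.2 ⟨Int.ceil_le.2 (by linarith), Int.le_floor.2 (by linarith)⟩
  have hcard := Finset.card_le_card hsub
  rw [Int.card_Icc] at hcard
  rcases le_total 0 (⌊a + w⌋ + 1 - ⌈a - w⌉) with h | h
  · have h1 : (G.card : ℤ) ≤ ⌊a + w⌋ + 1 - ⌈a - w⌉ := by omega
    have h2 : (G.card : ℝ) ≤ ⌊a + w⌋ + 1 - ⌈a - w⌉ := by exact_mod_cast h1
    linarith [Int.floor_le (a + w), Int.le_ceil (a - w)]
  · have : G.card = 0 := by omega
    rw [this, Nat.cast_zero]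
    positivity

/-- A set `S` whose `s`-neighbourhood covers half of an interval contains a large family of points
attached to distinct cells of the grid `s ℤ`. -/
lemma exists_grid_points {S : Set ℝ} {x₀ r s : ℝ} (hs : 0 < s) (hsr : 2 * s ≤ r)
    (hS : ENNReal.ofReal r ≤ volume {x ∈ Metric.closedBall x₀ r | ∃ α ∈ S, |x - α| ≤ s}) :
    ∃ (G : Finset ℤ) (α : ℤ → ℝ), (∀ j ∈ G, α j ∈ S ∧ |α j - j * s| ≤ 2 * s ∧ |α j - x₀| ≤ r + s) ∧
      r ≤ G.card * s ∧ G.card * s ≤ 5 * r := by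
  classical
  set T := {x ∈ Metric.closedBall x₀ r | ∃ α ∈ S, |x - α| ≤ s} with hT
  have hfloor : ∀ x : ℝ, |x / s - ⌊x / s⌋| ≤ 1 := fun x => by
    rw [abs_of_nonneg (by linarith [Int.floor_le (x / s)])]
    linarith [Int.lt_floor_add_one (x / s)]
  have hfloor' : ∀ x : ℝ, |x - ⌊x / s⌋ * s| ≤ s := fun x => by
    have h : x - ⌊x / s⌋ * s = (x / s - ⌊x / s⌋) * s := by
      rw [sub_mul, div_mul_cancel₀ _ hs.ne']
    rw [h, abs_mul, abs_of_pos hs]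
    exact mul_le_of_le_one_left hs.le (hfloor x)
  set G := (Finset.Icc ⌊(x₀ - r) / s⌋ ⌊(x₀ + r) / s⌋).filter fun j => ∃ x ∈ T, ⌊x / s⌋ = j with hG
  have hmem : ∀ x ∈ T, ⌊x / s⌋ ∈ G := by
    intro x hx
    have h1 := hx.1
    rw [Metric.mem_closedBall, Real.dist_eq, abs_le] at h1
    refine Finset.mem_filter.2 ⟨Finset.mem_Icc.2 ⟨?_, ?_⟩, x, hx, rfl⟩
    · exact Int.floor_le_floor (by gcongr; linarith)
    · exact Int.floor_le_floor (by gcongr; linarith)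
  have hα : ∀ j : ℤ, ∃ a : ℝ, j ∈ G → a ∈ S ∧ |a - j * s| ≤ 2 * s ∧ |a - x₀| ≤ r + s := by
    intro j
    by_cases hj : j ∈ G
    · obtain ⟨-, x, ⟨hx, a, ha, hxa⟩, rfl⟩ := Finset.mem_filter.1 hj
      rw [Metric.mem_closedBall, Real.dist_eq] at hx
      rw [abs_sub_comm] at hxa
      refine ⟨a, fun _ => ⟨ha, ?_, ?_⟩⟩
      · linarith [abs_sub_le a x (⌊x / s⌋ * s), hfloor' x]
      · linarith [abs_sub_le a x x₀]
    · exact ⟨0, fun h => absurd h hj⟩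
  choose α hα using hα
  refine ⟨G, α, hα, ?_, ?_⟩
  · have hcov : T ⊆ ⋃ j ∈ G, Set.Ico ((j : ℝ) * s) (j * s + s) := by
      intro x hx
      refine Set.mem_biUnion (hmem x hx) ⟨?_, ?_⟩
      · exact (le_div_iff₀ hs).1 (Int.floor_le _)
      · have := (div_lt_iff₀ hs).1 (Int.lt_floor_add_one (x / s))
        linarith
    have h1 := hS.trans ((measure_mono hcov).trans (measure_biUnion_finset_le _ _))
    simp_rw [Real.volume_Ico, add_sub_cancel_left] at h1
    rw [Finset.sum_const, nsmul_eq_mul, ← ENNReal.ofReal_natCast, ← ENNReal.ofReal_mul (by positivity),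
      ENNReal.ofReal_le_ofReal_iff (by positivity)] at h1
    exact h1
  · have h := card_le_of_abs_sub_le (G := G) (a := x₀ / s) (w := r / s + 1)
      (by have : 0 ≤ r / s := div_nonneg (by linarith) hs.le
          linarith) ?_
    · have h2 : (G.card : ℝ) * s ≤ (2 * (r / s + 1) + 1) * s := by gcongr
      have h3 : (2 * (r / s + 1) + 1) * s = 2 * r + 3 * s := by
        field_simp
        ring
      linarith
    · intro j hj
      obtain ⟨-, x, ⟨hx, -⟩, rfl⟩ := Finset.mem_filter.1 hj
      rw [Metric.mem_closedBall, Real.dist_eq] at hx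
      have h1 : |x / s - x₀ / s| ≤ r / s := by
        rw [← sub_div, abs_div, abs_of_pos hs]
        gcongr
      have h2 := hfloor x
      rw [abs_sub_comm] at h2
      linarith [abs_sub_le (⌊x / s⌋ : ℝ) (x / s) (x₀ / s)]

lemma volumeReal_ball {a r : ℝ} (hr : 0 ≤ r) : volume.real (Metric.ball a r) = 2 * r := by
  rw [measureReal_def, Real.volume_ball, ENNReal.toReal_ofReal (by positivity)]

lemma sum_volumeReal_inter_ball_le {G : Finset ℤ} {α : ℤ → ℝ} {s c ψ ψ' : ℝ} (hs : 0 < s)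
    (hα : ∀ j ∈ G, |α j - j * s| ≤ 2 * s) (hψ : 0 ≤ ψ) (hψ' : 0 ≤ ψ') (hψs : ψ' ≤ s) :
    ∑ j ∈ G, volume.real (Metric.ball c ψ ∩ Metric.ball (α j) ψ') ≤ 2 * ψ' * (2 * ψ / s + 7) := by
  classical
  calc ∑ j ∈ G, volume.real (Metric.ball c ψ ∩ Metric.ball (α j) ψ')
      ≤ ∑ j ∈ G, if |α j - c| < ψ + ψ' then 2 * ψ' else 0 := by
        refine Finset.sum_le_sum fun j _ => ?_
        split_ifs with h
        · rw [← volumeReal_ball hψ' (a := α j)]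
          exact measureReal_mono Set.inter_subset_right measure_ball_lt_top.ne
        · have : Metric.ball c ψ ∩ Metric.ball (α j) ψ' = ∅ := by
            refine Set.disjoint_iff_inter_eq_empty.1 (Metric.ball_disjoint_ball ?_)
            rw [dist_comm, Real.dist_eq]
            exact not_lt.1 h
          rw [this, measureReal_empty]
    _ = (G.filter fun j => |α j - c| < ψ + ψ').card * (2 * ψ') := by
        rw [← Finset.sum_filter, Finset.sum_const, nsmul_eq_mul]
    _ ≤ (2 * ((ψ + ψ') / s + 2) + 1) * (2 * ψ') := by
        gcongr
        refine card_le_of_abs_sub_le (a := c / s) (by positivity) fun j hj => ?_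
        obtain ⟨hjG, hj⟩ := Finset.mem_filter.1 hj
        have h1 := hα j hjG
        rw [abs_sub_comm] at h1
        have h2 : |(j : ℝ) * s - c| ≤ ψ + ψ' + 2 * s := by
          linarith [abs_sub_le ((j : ℝ) * s) (α j) c]
        have h3 : (j : ℝ) - c / s = (j * s - c) / s := by field_simp
        have h4 : (ψ + ψ') / s + 2 = (ψ + ψ' + 2 * s) / s := by field_simp
        rw [h3, h4, abs_div, abs_of_pos hs]
        gcongr
    _ ≤ 2 * ψ' * (2 * ψ / s + 7) := by
        have h5 : ψ' / s ≤ 1 := (div_le_one hs).2 hψs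
        rw [add_div, mul_div_assoc]
        nlinarith

lemma sum_ite_pow_sub_le (J : Finset ℕ) {σ : ℝ} (hσ : 0 < σ) (hσ2 : σ ≤ 1 / 2) (l : ℕ) :
    ∑ k ∈ J, (if k ≤ l then σ ^ (l - k) else 0) ≤ 2 := by
  classical
  calc ∑ k ∈ J, (if k ≤ l then σ ^ (l - k) else 0)
      = ∑ k ∈ J.filter (· ≤ l), σ ^ (l - k) := by rw [Finset.sum_filter]
    _ ≤ ∑ k ∈ Finset.range (l + 1), σ ^ (l - k) := by
        refine Finset.sum_le_sum_of_subset_of_nonneg (fun k hk => ?_) fun _ _ _ => by positivity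
        exact Finset.mem_range.2 (Nat.lt_succ_of_le (Finset.mem_filter.1 hk).2)
    _ = ∑ k ∈ Finset.range (l + 1), σ ^ k := by
        rw [← Finset.sum_range_reflect]
        exact Finset.sum_congr rfl fun k hk => by
          have := Finset.mem_range.1 hk
          congr 1
          omega
    _ ≤ ∑ k ∈ Finset.range (l + 1), (1 / 2 : ℝ) ^ k := by gcongr
    _ ≤ 2 := sum_geometric_two_le _

/-- A union of quasi-independent families of balls occupies a fixed proportion of an interval. -/
lemma le_volumeReal_iUnion_ball {J : Finset ℕ} {σ r : ℝ} (hr : 0 < r) (hσ : 0 < σ)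
    (hσ2 : σ ≤ 1 / 2) {b : ℕ → ℝ} (hb0 : ∀ k, 0 ≤ b k) (hb1 : ∀ k, b k ≤ 1)
    (hB : 1 ≤ ∑ k ∈ J, b k) {G : ℕ → Finset ℤ} {α : ℕ → ℤ → ℝ}
    (hα : ∀ k ∈ J, ∀ j ∈ G k, |α k j - j * σ ^ k| ≤ 2 * σ ^ k)
    (hG1 : ∀ k ∈ J, r ≤ (G k).card * σ ^ k) (hG2 : ∀ k ∈ J, (G k).card * σ ^ k ≤ 5 * r) :
    r ≤ 75 * volume.real (⋃ p ∈ J.sigma G, Metric.ball (α p.1 p.2) (b p.1 * σ ^ p.1)) := by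
  classical
  have hψ : ∀ k, 0 ≤ b k * σ ^ k := fun k => mul_nonneg (hb0 k) (by positivity)
  set B := ∑ k ∈ J, b k with hBdef
  set E : (_ : ℕ) × ℤ → Set ℝ := fun p => Metric.ball (α p.1 p.2) (b p.1 * σ ^ p.1) with hE
  set u := volume.real (⋃ p ∈ J.sigma G, E p) with hu
  have hmain := sq_sum_measureReal_le volume (J.sigma G) (E := E) (fun _ => measurableSet_ball)
    fun _ => measure_ball_lt_top.ne
  have hM1 : 2 * r * B ≤ ∑ p ∈ J.sigma G, volume.real (E p) := by
    rw [Finset.sum_sigma, hBdef, Finset.mul_sum]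
    refine Finset.sum_le_sum fun k hk => ?_
    simp only [hE]
    rw [Finset.sum_congr rfl fun j _ => volumeReal_ball (hψ k), Finset.sum_const, nsmul_eq_mul]
    calc 2 * r * b k ≤ 2 * ((G k).card * σ ^ k) * b k := by
          gcongr
          · exact hb0 k
          · exact hG1 k hk
      _ = _ := by ring
  set q : ℕ → ℕ → ℝ := fun k l =>
    ∑ i ∈ G k, ∑ j ∈ G l, volume.real (E ⟨k, i⟩ ∩ E ⟨l, j⟩) with hq
  have hqsymm : ∀ k l, q k l = q l k := by
    intro k l
    simp only [hq]
    rw [Finset.sum_comm]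
    simp_rw [Set.inter_comm]
  set w : ℕ → ℕ → ℝ := fun k l => b l * if k ≤ l then σ ^ (l - k) else 0 with hw
  have hw0 : ∀ k l, 0 ≤ w k l := fun k l =>
    mul_nonneg (hb0 l) (by split_ifs <;> positivity)
  have hq1 : ∀ k ∈ J, ∀ l ∈ J, k ≤ l → q k l ≤ 5 * r * (4 * (b k * b l) + 14 * w k l) := by
    intro k hk l hl hkl
    have h1 : q k l ≤ ∑ i ∈ G k, 2 * (b l * σ ^ l) * (2 * (b k * σ ^ k) / σ ^ l + 7) := by
      refine Finset.sum_le_sum fun i _ => ?_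
      have := sum_volumeReal_inter_ball_le (c := α k i) (pow_pos hσ l) (hα l hl) (hψ k) (hψ l)
        (mul_le_of_le_one_left (pow_nonneg hσ.le l) (hb1 l))
      simpa only [hE] using this
    rw [Finset.sum_const, nsmul_eq_mul] at h1
    have h2 : σ ^ l = σ ^ k * σ ^ (l - k) := by rw [← pow_add, Nat.add_sub_cancel' hkl]
    have h3 : ((G k).card : ℝ) * (2 * (b l * σ ^ l) * (2 * (b k * σ ^ k) / σ ^ l + 7)) =
        (G k).card * σ ^ k * (4 * (b k * b l) + 14 * w k l) := by
      simp only [hw, if_pos hkl]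
      have h4 : 2 * (b l * σ ^ l) * (2 * (b k * σ ^ k) / σ ^ l + 7) =
          4 * b l * b k * σ ^ k + 14 * b l * σ ^ l := by
        field_simp
        ring
      rw [h4, h2]
      ring
    rw [h3] at h1
    refine h1.trans ?_
    have := hG2 k hk
    have := mul_nonneg (hb0 k) (hb0 l)
    have := hw0 k l
    gcongr
  have hq2 : ∀ k ∈ J, ∀ l ∈ J, q k l ≤ 5 * r * (4 * (b k * b l) + 14 * (w k l + w l k)) := by
    intro k hk l hl
    rcases le_total k l with h | h
    · refine (hq1 k hk l hl h).trans ?_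
      have := hw0 l k
      gcongr
      linarith
    · rw [hqsymm]
      refine (hq1 l hl k hk h).trans ?_
      have := hw0 k l
      rw [mul_comm (b k)]
      gcongr
      linarith
  have hws : ∑ k ∈ J, ∑ l ∈ J, w k l ≤ 2 * B := by
    rw [Finset.sum_comm, hBdef, Finset.mul_sum]
    refine Finset.sum_le_sum fun l _ => ?_
    simp only [hw]
    rw [← Finset.mul_sum, mul_comm 2]
    exact mul_le_mul_of_nonneg_left (sum_ite_pow_sub_le J hσ hσ2 l) (hb0 l)
  have hM2 : ∑ p ∈ J.sigma G, ∑ p' ∈ J.sigma G, volume.real (E p ∩ E p') ≤ 300 * r * B ^ 2 := by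
    have h1 : ∑ p ∈ J.sigma G, ∑ p' ∈ J.sigma G, volume.real (E p ∩ E p') =
        ∑ k ∈ J, ∑ l ∈ J, q k l := by
      simp_rw [Finset.sum_sigma]
      refine Finset.sum_congr rfl fun k _ => ?_
      rw [Finset.sum_comm]
    have h2 : ∑ k ∈ J, ∑ l ∈ J, b k * b l = B ^ 2 := by rw [sq, hBdef, Finset.sum_mul_sum]
    have h3 : ∑ k ∈ J, ∑ l ∈ J, w l k = ∑ k ∈ J, ∑ l ∈ J, w k l := Finset.sum_comm
    rw [h1]
    calc ∑ k ∈ J, ∑ l ∈ J, q k l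
        ≤ ∑ k ∈ J, ∑ l ∈ J, 5 * r * (4 * (b k * b l) + 14 * (w k l + w l k)) :=
          Finset.sum_le_sum fun k hk => Finset.sum_le_sum fun l hl => hq2 k hk l hl
      _ = 5 * r * (4 * B ^ 2 + 14 * (∑ k ∈ J, ∑ l ∈ J, w k l + ∑ k ∈ J, ∑ l ∈ J, w k l)) := by
          simp_rw [← Finset.mul_sum, Finset.sum_add_distrib, ← Finset.mul_sum,
            Finset.sum_add_distrib, h3]
          rw [← h2]
          simp_rw [Finset.mul_sum]
      _ ≤ 5 * r * (4 * B ^ 2 + 14 * (2 * B + 2 * B)) := by gcongr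
      _ ≤ 300 * r * B ^ 2 := by nlinarith [mul_le_mul_of_nonneg_left hB (by positivity : 0 ≤ r * B)]
  have hu0 : 0 ≤ u := measureReal_nonneg
  have hfinal : (2 * r * B) ^ 2 ≤ 300 * r * B ^ 2 * u :=
    (pow_le_pow_left₀ (by positivity) hM1 2).trans (hmain.trans (by gcongr))
  have hpos : 0 < 4 * r * B ^ 2 := by positivity
  refine le_of_mul_le_mul_left ?_ hpos
  linarith

/-- The balls of radius `b k * σ ^ k` around a ubiquitous system occupy a fixed proportion of every
interval if `b` is not summable. -/
lemma le_volumeReal_inter_closedBall {σ : ℝ} (hσ : 0 < σ) (hσ2 : σ ≤ 1 / 2) {S : ℕ → Set ℝ}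
    {b : ℕ → ℝ} (hb0 : ∀ k, 0 ≤ b k) (hb1 : ∀ k, b k ≤ 1) (hb : ¬ Summable b) {x₀ r : ℝ}
    (hr : 0 < r) {k₀ : ℕ} (hS : ∀ k, k₀ ≤ k → ENNReal.ofReal r ≤
      volume {x ∈ Metric.closedBall x₀ r | ∃ α ∈ S k, |x - α| ≤ σ ^ k}) (N : ℕ) :
    r ≤ 75 * volume.real ((⋃ k ≥ N, ⋃ a ∈ S k, Metric.ball a (b k * σ ^ k)) ∩
      Metric.closedBall x₀ (2 * r)) := by
  obtain ⟨k₁, hk₁⟩ := exists_pow_lt_of_lt_one (half_pos hr) (by linarith : σ < 1)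
  set K := max N (max k₀ k₁) with hK
  have hsmall : ∀ k, K ≤ k → 2 * σ ^ k ≤ r := by
    intro k hk
    have : σ ^ k ≤ σ ^ k₁ := pow_le_pow_of_le_one hσ.le (by linarith) (by omega)
    linarith
  have htend := (not_summable_iff_tendsto_nat_atTop_of_nonneg fun k => hb0 (k + K)).1
    (fun h => hb ((summable_nat_add_iff K).1 h))
  obtain ⟨m, hm⟩ := (htend.eventually_ge_atTop 1).exists
  set J := Finset.Ico K (K + m) with hJ
  have hB : 1 ≤ ∑ k ∈ J, b k := by
    rw [hJ, Finset.sum_Ico_eq_sum_range, Nat.add_sub_cancel_left]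
    simpa only [add_comm K] using hm
  have hex : ∀ k, ∃ (G : Finset ℤ) (α : ℤ → ℝ), K ≤ k →
      (∀ j ∈ G, α j ∈ S k ∧ |α j - j * σ ^ k| ≤ 2 * σ ^ k ∧ |α j - x₀| ≤ r + σ ^ k) ∧
      r ≤ G.card * σ ^ k ∧ G.card * σ ^ k ≤ 5 * r := by
    intro k
    by_cases hk : K ≤ k
    · obtain ⟨G, α, h⟩ := exists_grid_points (by positivity) (hsmall k hk) (hS k (by omega))
      exact ⟨G, α, fun _ => h⟩
    · exact ⟨∅, 0, fun h => absurd h hk⟩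
  choose G α hGα using hex
  have hJK : ∀ k ∈ J, K ≤ k := fun k hk => (Finset.mem_Ico.1 hk).1
  have h1 := le_volumeReal_iUnion_ball hr hσ hσ2 hb0 hb1 hB (G := G) (α := α)
    (fun k hk j hj => ((hGα k (hJK k hk)).1 j hj).2.1) (fun k hk => (hGα k (hJK k hk)).2.1)
    (fun k hk => (hGα k (hJK k hk)).2.2)
  refine h1.trans (mul_le_mul_of_nonneg_left (measureReal_mono ?_ ?_) (by norm_num))
  · refine Set.iUnion₂_subset fun p hp => ?_
    obtain ⟨hpJ, hpG⟩ := Finset.mem_sigma.1 hp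
    have hk := hJK _ hpJ
    obtain ⟨hpS, -, hpx⟩ := (hGα p.1 hk).1 p.2 hpG
    refine Set.subset_inter (fun y hy => ?_) ?_
    · exact Set.mem_iUnion₂.2 ⟨p.1, (le_max_left _ _).trans hk, Set.mem_iUnion₂.2 ⟨_, hpS, hy⟩⟩
    · refine Metric.ball_subset_closedBall.trans (Metric.closedBall_subset_closedBall' ?_)
      rw [Real.dist_eq]
      have h2 := hsmall _ hk
      have h3 : b p.1 * σ ^ p.1 ≤ σ ^ p.1 := mul_le_of_le_one_left (by positivity) (hb1 _)
      linarith
  · exact measure_inter_ne_top_of_right_ne_top measure_closedBall_lt_top.ne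

/-- A ubiquitous system on `(-X, X)` approximates almost every point of `(-X, X)` infinitely often
to the precision `b k * σ ^ k`, provided `b` is not summable. -/
lemma ae_exists_abs_sub_lt {X σ : ℝ} (hσ : 0 < σ) (hσ2 : σ ≤ 1 / 2) {S : ℕ → Set ℝ}
    {b : ℕ → ℝ} (hb0 : ∀ k, 0 ≤ b k) (hb1 : ∀ k, b k ≤ 1) (hb : ¬ Summable b)
    (hS : ∀ x₀ r : ℝ, 0 < r → |x₀| + r ≤ X → ∃ k₀, ∀ k, k₀ ≤ k → ENNReal.ofReal r ≤
      volume {x ∈ Metric.closedBall x₀ r | ∃ α ∈ S k, |x - α| ≤ σ ^ k}) (N : ℕ) :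
    ∀ᵐ x : ℝ, |x| < X → ∃ k ≥ N, ∃ a ∈ S k, |x - a| < b k * σ ^ k := by
  set U := ⋃ k ≥ N, ⋃ a ∈ S k, Metric.ball a (b k * σ ^ k) with hU
  have hUo : IsOpen U := isOpen_biUnion fun k _ => isOpen_biUnion fun a _ => Metric.isOpen_ball
  have hUm := hUo.measurableSet
  filter_upwards [Besicovitch.ae_tendsto_measure_inter_div_of_measurableSet volume hUm.compl]
    with x hx hxX
  by_contra hcon
  have hxU : x ∈ Uᶜ := by
    intro h
    obtain ⟨k, hk, h⟩ := Set.mem_iUnion₂.1 h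
    obtain ⟨a, ha, h⟩ := Set.mem_iUnion₂.1 h
    exact hcon ⟨k, hk, a, ha, h⟩
  rw [Set.indicator_of_mem hxU, Pi.one_apply] at hx
  have hev := hx.eventually (lt_mem_nhds (show ENNReal.ofReal (299 / 300) < 1 by
    rw [← ENNReal.ofReal_one]
    exact (ENNReal.ofReal_lt_ofReal_iff one_pos).2 (by norm_num)))
  obtain ⟨ρ, hρ, hρ0, hρX⟩ :=
    (hev.and (Ioo_mem_nhdsGT (show (0 : ℝ) < X - |x| by linarith))).exists
  obtain ⟨k₀, hk₀⟩ := hS x (ρ / 2) (by linarith) (by linarith)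
  have hlow := le_volumeReal_inter_closedBall hσ hσ2 hb0 hb1 hb (half_pos hρ0) hk₀ N
  rw [← hU, mul_div_cancel₀ ρ two_ne_zero] at hlow
  have hfin : volume (Metric.closedBall x ρ) ≠ ⊤ := measure_closedBall_lt_top.ne
  have hball : volume.real (Metric.closedBall x ρ) = 2 * ρ := by
    rw [measureReal_def, Real.volume_closedBall, ENNReal.toReal_ofReal (by linarith)]
  have hsplit := measureReal_inter_add_sdiff (μ := volume) (s := Metric.closedBall x ρ) hUm hfin
  rw [hball, Set.inter_comm, Set.sdiff_eq, Set.inter_comm _ Uᶜ] at hsplit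
  rw [← ENNReal.ofReal_toReal (measure_inter_ne_top_of_right_ne_top hfin (s := Uᶜ)),
    ← ENNReal.ofReal_toReal hfin, ← measureReal_def, ← measureReal_def, hball,
    ← ENNReal.ofReal_div_of_pos (by linarith), ENNReal.ofReal_lt_ofReal_iff_of_nonneg (by norm_num),
    lt_div_iff₀ (by linarith)] at hρ
  linarith

/-- The real algebraic numbers of degree `n` and height at most `N`. -/
def algSet (n N : ℕ) : Set ℝ :=
  {α | ∃ P : Polynomial ℤ, IsMinIntPoly α P ∧ P.natDegree = n ∧ intPolyHeight P ≤ N}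

/-- Algebraic numbers of degree exactly `n` form a ubiquitous system on bounded intervals. -/
lemma exists_le_volume_near_algSet {n : ℕ} (hn : 0 < n) (X : ℝ) :
    ∃ c : ℕ, ∀ x₀ r : ℝ, 0 < r → |x₀| + r ≤ X → ∃ k₀, ∀ k, k₀ ≤ k → ENNReal.ofReal r ≤
      volume {x ∈ Metric.closedBall x₀ r |
        ∃ α ∈ algSet n (2 ^ (c + k)), |x - α| ≤ (1 / 2 ^ (n + 1) : ℝ) ^ k} := by
  obtain ⟨δ, hδ, -, H⟩ := exists_volume_short_vector_le n one_pos
  obtain ⟨C, hC, HC⟩ := exists_isMinIntPoly_near hn X hδ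
  obtain ⟨c, hc⟩ := pow_unbounded_of_one_lt C one_lt_two
  refine ⟨c, fun x₀ r hr hX => ?_⟩
  obtain ⟨Q₀, hQ₀, HQ⟩ := H x₀ r hr
  obtain ⟨k₀, hk₀⟩ := pow_unbounded_of_one_lt Q₀ one_lt_two
  refine ⟨k₀, fun k hk => ?_⟩
  have hQk : Q₀ ≤ (2 : ℝ) ^ k := hk₀.le.trans (pow_le_pow_right₀ one_le_two hk)
  set good := {x ∈ Metric.closedBall x₀ r |
    ∃ α ∈ algSet n (2 ^ (c + k)), |x - α| ≤ (1 / 2 ^ (n + 1) : ℝ) ^ k} with hgood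
  have hcov : Metric.closedBall x₀ r ⊆ good ∪ {z ∈ Metric.closedBall x₀ r |
      ∃ v : Fin (n + 1) → ℤ, v ≠ 0 ∧ ∀ i, |(twistMat n (2 ^ k) z).mulVec (realVec v) i| ≤ δ} := by
    intro x hx
    by_cases h : ∃ v : Fin (n + 1) → ℤ, v ≠ 0 ∧
        ∀ i, |(twistMat n (2 ^ k) x).mulVec (realVec v) i| ≤ δ
    · exact Or.inr ⟨hx, h⟩
    · left
      push Not at h
      have hxX : |x| ≤ X := by
        rw [Metric.mem_closedBall, Real.dist_eq] at hx
        linarith [abs_sub_abs_le_abs_sub x x₀]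
      obtain ⟨α, P, hP, hdeg, hht, hα⟩ := HC (2 ^ k) (hQ₀.trans hQk) x hxX h
      refine ⟨hx, α, ⟨P, hP, hdeg, ?_⟩, ?_⟩
      · have : (intPolyHeight P : ℝ) ≤ 2 ^ (c + k) := by
          rw [pow_add]
          refine hht.trans ?_
          gcongr
        exact_mod_cast this
      · rwa [div_pow, one_pow, ← pow_mul, mul_comm (n + 1), pow_mul]
  have h1 := (measure_mono (μ := volume) hcov).trans (measure_union_le _ _)
  have h2 := h1.trans (add_le_add_right (HQ _ hQk) _)
  rw [Real.volume_closedBall, one_mul, two_mul, ENNReal.ofReal_add hr.le hr.le] at h2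
  exact ENNReal.le_of_add_le_add_right ENNReal.ofReal_ne_top h2

lemma intPolyHeight_pos {P : Polynomial ℤ} (hP : P ≠ 0) : 0 < intPolyHeight P := by
  refine lt_of_lt_of_le (Int.natAbs_pos.2 (Polynomial.leadingCoeff_ne_zero.2 hP)) ?_
  exact Finset.le_sup (f := fun i => (P.coeff i).natAbs)
    (Finset.mem_range.2 (Nat.lt_succ_self P.natDegree))

lemma summable_condensed_iff {Ψ : ℕ → ℝ} (hpos : ∀ h, 0 < Ψ h) (hmono : Antitone Ψ) :
    (Summable fun k : ℕ => (2 : ℝ) ^ k * Ψ (2 ^ k)) ↔ Summable Ψ :=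
  summable_condensed_iff_of_nonneg (fun h => (hpos h).le) fun _ _ _ h => hmono h

lemma not_summable_min_one {Ψ : ℕ → ℝ} (hpos : ∀ h, 0 < Ψ h) (hmono : Antitone Ψ)
    (hΨ : ¬ Summable Ψ) {κ : ℝ} (hκ : 0 < κ) (c : ℕ) :
    ¬ Summable fun k : ℕ => min 1 (κ * (2 ^ (k + c) * Ψ (2 ^ (k + c)))) := by
  intro h
  refine hΨ ((summable_condensed_iff hpos hmono).1 ((summable_nat_add_iff c).1 ?_))
  have hev := h.tendsto_atTop_zero.eventually (gt_mem_nhds (zero_lt_one (α := ℝ)))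
  obtain ⟨N, hN⟩ := Filter.eventually_atTop.1 hev
  rw [← summable_nat_add_iff N]
  refine (summable_mul_left_iff hκ.ne').1 (((summable_nat_add_iff N).2 h).congr fun k => ?_)
  have := hN (k + N) (by omega)
  exact min_eq_right (le_of_not_ge fun hle => absurd this (by rw [min_eq_left hle]; exact lt_irrefl _))

lemma zpow_neg_mul_le_of_le {Ψ : ℕ → ℝ} (hpos : ∀ h, 0 < Ψ h) (hmono : Antitone Ψ) (n : ℕ)
    {a b : ℕ} (ha : 0 < a) (hab : a ≤ b) :
    (b : ℝ) ^ (-(n : ℤ)) * Ψ b ≤ (a : ℝ) ^ (-(n : ℤ)) * Ψ a := by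
  have ha' : (0 : ℝ) < a := by exact_mod_cast ha
  rw [zpow_neg, zpow_neg, zpow_natCast, zpow_natCast]
  have := hmono hab
  have := hpos b
  gcongr

/-- The divergence case on a bounded interval. -/
lemma ae_infinite_of_not_summable {n : ℕ} (hn : 0 < n) {Ψ : ℕ → ℝ} (hpos : ∀ h, 0 < Ψ h)
    (hmono : Antitone Ψ) (hΨ : ¬ Summable Ψ) (X : ℝ) :
    ∀ᵐ ξ : ℝ, |ξ| < X → {α : ℝ | ∃ P : Polynomial ℤ, IsMinIntPoly α P ∧ P.natDegree = n ∧
        |ξ - α| < (intPolyHeight P : ℝ) ^ (-(n : ℤ)) * Ψ (intPolyHeight P)}.Infinite := by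
  obtain ⟨c, hc⟩ := exists_le_volume_near_algSet hn X
  set σ : ℝ := 1 / 2 ^ (n + 1) with hσ
  have hσ0 : 0 < σ := by positivity
  have hσ2 : σ ≤ 1 / 2 := by
    rw [hσ]
    gcongr
    exact le_self_pow₀ one_le_two (by omega)
  set κ : ℝ := 1 / 2 ^ ((n + 1) * c) with hκ
  have hκ0 : 0 < κ := by positivity
  set b : ℕ → ℝ := fun k => min 1 (κ * (2 ^ (k + c) * Ψ (2 ^ (k + c)))) with hb
  have hb0 : ∀ k, 0 ≤ b k := fun k => le_min zero_le_one (by have := hpos (2 ^ (k + c)); positivity)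
  have hb1 : ∀ k, b k ≤ 1 := fun k => min_le_left _ _
  have hprec : ∀ k, b k * σ ^ k ≤ ((2 ^ (c + k) : ℕ) : ℝ) ^ (-(n : ℤ)) * Ψ (2 ^ (c + k)) := by
    intro k
    calc b k * σ ^ k ≤ κ * (2 ^ (k + c) * Ψ (2 ^ (k + c))) * σ ^ k := by
          gcongr
          exact min_le_right _ _
      _ = _ := by
          rw [hκ, hσ, zpow_neg, zpow_natCast, add_comm c]
          push_cast
          rw [div_pow, one_pow, ← pow_mul, ← pow_mul]
          field_simp
          have hpow : (2 : ℝ) ^ (k + c) * 2 ^ ((k + c) * n) = 2 ^ ((n + 1) * c) * 2 ^ ((n + 1) * k) := by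
            rw [← pow_add, ← pow_add]
            congr 1
            ring
          linear_combination Ψ (2 ^ (k + c)) * hpow
  have halg : ∀ᵐ ξ : ℝ, ξ ∉ {α : ℝ | IsAlgebraic ℤ α} :=
    (Algebraic.countable ℤ ℝ).ae_notMem volume
  have hall := ae_all_iff.2 fun N =>
    ae_exists_abs_sub_lt hσ0 hσ2 hb0 hb1 (not_summable_min_one hpos hmono hΨ hκ0 c) hc N
  filter_upwards [hall, halg] with ξ hξ hξalg hξX
  by_contra hinf
  have hfin := Set.not_infinite.1 hinf
  clear hinf
  set T := {α : ℝ | ∃ P : Polynomial ℤ, IsMinIntPoly α P ∧ P.natDegree = n ∧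
    |ξ - α| < (intPolyHeight P : ℝ) ^ (-(n : ℤ)) * Ψ (intPolyHeight P)} with hT
  have hξT : ξ ∈ Tᶜ := fun ⟨P, hP, _⟩ => hξalg ⟨P, hP.1, hP.2.2.2.1⟩
  obtain ⟨ε, hε, hball⟩ := Metric.isOpen_iff.1 hfin.isClosed.isOpen_compl ξ hξT
  obtain ⟨N, hN⟩ := exists_pow_lt_of_lt_one hε (by linarith : σ < 1)
  obtain ⟨k, hk, α, ⟨P, hP, hdeg, hht⟩, hα⟩ := hξ N hξX
  have hαT : α ∈ T := ⟨P, hP, hdeg, hα.trans_le ((hprec k).trans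
    (zpow_neg_mul_le_of_le hpos hmono n (intPolyHeight_pos hP.1) hht))⟩
  refine hball ?_ hαT
  rw [Metric.mem_ball, dist_comm, Real.dist_eq]
  calc |ξ - α| < b k * σ ^ k := hα
    _ ≤ σ ^ k := mul_le_of_le_one_left (by positivity) (hb1 k)
    _ ≤ σ ^ N := pow_le_pow_of_le_one hσ0.le (by linarith) hk
    _ < ε := hN

lemma exists_finset_algSet_subset (n N : ℕ) :
    ∃ S : Finset ℝ, algSet n N ⊆ S ∧ S.card ≤ (2 * N + 1) ^ (n + 1) * n := by
  classical
  set poly : (Fin (n + 1) → ℤ) → Polynomial ℤ := fun v =>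
    ∑ i : Fin (n + 1), Polynomial.C (v i) * Polynomial.X ^ (i : ℕ) with hpoly
  set box : Finset (Fin (n + 1) → ℤ) := Fintype.piFinset fun _ => Finset.Icc (-(N : ℤ)) N
  refine ⟨box.biUnion fun v => ((poly v).aroots ℝ).toFinset, ?_, ?_⟩
  · rintro α ⟨P, hP, hdeg, hht⟩
    have hPv : poly (fun i => P.coeff i) = P := by
      conv_rhs => rw [P.as_sum_range_C_mul_X_pow, hdeg]
      exact Fin.sum_univ_eq_sum_range
        (fun i => Polynomial.C (P.coeff i) * Polynomial.X ^ i) (n + 1)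
    refine Finset.mem_coe.2 (Finset.mem_biUnion.2 ⟨fun i => P.coeff i, ?_, ?_⟩)
    · refine Fintype.mem_piFinset.2 fun i => Finset.mem_Icc.2 (abs_le.1 ?_)
      rw [Int.abs_eq_natAbs]
      refine Int.ofNat_le.2 (le_trans ?_ hht)
      exact Finset.le_sup (f := fun i => (P.coeff i).natAbs)
        (Finset.mem_range.2 (by omega : (i : ℕ) < P.natDegree + 1))
    · rw [hPv, Multiset.mem_toFinset, Polynomial.mem_aroots]
      exact ⟨hP.1, hP.2.2.2.1⟩
  · have hbox : box.card = (2 * N + 1) ^ (n + 1) := by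
      rw [Fintype.card_piFinset, Finset.prod_const, Finset.card_univ, Fintype.card_fin,
        Int.card_Icc]
      congr 1
      omega
    rw [← hbox]
    refine Finset.card_biUnion_le_card_mul _ _ _ fun v _ => ?_
    refine (Multiset.toFinset_card_le _).trans ((Polynomial.card_roots' _).trans ?_)
    refine Polynomial.natDegree_map_le.trans (Polynomial.natDegree_sum_le_of_forall_le _ _ ?_)
    exact fun i _ => (Polynomial.natDegree_C_mul_X_pow_le _ _).trans (by omega)

/-- The convergence case. -/
lemma volume_infinite_eq_zero_of_summable (n : ℕ) {Ψ : ℕ → ℝ} (hpos : ∀ h, 0 < Ψ h)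
    (hmono : Antitone Ψ) (hΨ : Summable Ψ) :
    volume {ξ : ℝ | {α : ℝ | ∃ P : Polynomial ℤ, IsMinIntPoly α P ∧ P.natDegree = n ∧
        |ξ - α| < (intPolyHeight P : ℝ) ^ (-(n : ℤ)) * Ψ (intPolyHeight P)}.Infinite} = 0 := by
  choose S hS hScard using exists_finset_algSet_subset n
  set r : ℕ → ℝ := fun k => ((2 ^ k : ℕ) : ℝ) ^ (-(n : ℤ)) * Ψ (2 ^ k) with hr
  set E : ℕ → Set ℝ := fun k => ⋃ α ∈ S (2 ^ (k + 1)), Metric.ball α (r k) with hE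
  set C : ℝ := 8 ^ (n + 1) * n * 2
  have hEvol : ∀ k, volume (E k) ≤ ENNReal.ofReal (C * (2 ^ k * Ψ (2 ^ k))) := by
    intro k
    have hcard : ((S (2 ^ (k + 1))).card : ℝ) ≤ (8 * 2 ^ k) ^ (n + 1) * n := by
      have h1 : 2 * 2 ^ (k + 1) + 1 ≤ 8 * 2 ^ k := by
        have := Nat.one_le_two_pow (n := k)
        rw [pow_succ]
        omega
      exact_mod_cast (hScard (2 ^ (k + 1))).trans
        (Nat.mul_le_mul_right n (Nat.pow_le_pow_left h1 (n + 1)))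
    have hrpos : 0 < r k := by
      have := hpos (2 ^ k)
      positivity
    calc volume (E k) ≤ ∑ α ∈ S (2 ^ (k + 1)), volume (Metric.ball α (r k)) :=
          measure_biUnion_finset_le _ _
      _ = ENNReal.ofReal ((S (2 ^ (k + 1))).card * (2 * r k)) := by
          simp only [Real.volume_ball, Finset.sum_const, nsmul_eq_mul]
          rw [ENNReal.ofReal_mul (Nat.cast_nonneg _), ENNReal.ofReal_natCast]
      _ ≤ ENNReal.ofReal ((8 * 2 ^ k) ^ (n + 1) * n * (2 * r k)) := by gcongr
      _ = ENNReal.ofReal (C * (2 ^ k * Ψ (2 ^ k))) := by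
          congr 1
          simp only [hr, C, zpow_neg, zpow_natCast]
          push_cast
          field_simp
          ring
  have hsum : ∑' k, volume (E k) ≠ ⊤ :=
    ne_top_of_le_ne_top (((summable_condensed_iff hpos hmono).2 hΨ).mul_left C).tsum_ofReal_ne_top
      (ENNReal.tsum_le_tsum hEvol)
  refine measure_mono_null ?_ (measure_setOfPred_frequently_eq_zero (p := fun k ξ => ξ ∈ E k) hsum)
  intro ξ hξ
  by_contra hfreq
  rw [Set.mem_ofPred_eq, Filter.not_frequently, Filter.eventually_atTop] at hfreq
  obtain ⟨K, hK⟩ := hfreq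
  refine hξ ((S (2 ^ K)).finite_toSet.subset fun α hα => hS _ ?_)
  obtain ⟨P, hP, hdeg, hlt⟩ := hα
  have hht := intPolyHeight_pos hP.1
  set k := Nat.log 2 (intPolyHeight P)
  have hle : intPolyHeight P ≤ 2 ^ (k + 1) := (Nat.lt_pow_succ_log_self one_lt_two _).le
  have hk : k < K := by
    by_contra hk
    refine hK k (not_lt.1 hk) (Set.mem_biUnion (hS _ ⟨P, hP, hdeg, hle⟩) ?_)
    rw [Metric.mem_ball, Real.dist_eq]
    exact hlt.trans_le (zpow_neg_mul_le_of_le hpos hmono n (Nat.two_pow_pos k)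
      (Nat.pow_log_le_self 2 hht.ne'))
  exact ⟨P, hP, hdeg, hle.trans (Nat.pow_le_pow_right two_pos hk)⟩

/-- Beresnevich's Khintchine-type theorem for approximation by real algebraic
numbers of exact degree `n`. -/
theorem beresnevich_khintchine_type (n : ℕ) (hn : 0 < n) (Ψ : ℕ → ℝ)
    (hpos : ∀ h : ℕ, 0 < Ψ h) (hmono : Antitone Ψ) :
    (¬ Summable Ψ →
      volume {ξ : ℝ | ¬ {α : ℝ | ∃ P : Polynomial ℤ, IsMinIntPoly α P ∧
        P.natDegree = n ∧
        |ξ - α| < (intPolyHeight P : ℝ) ^ (-(n : ℤ)) * Ψ (intPolyHeight P)}.Infinite} = 0) ∧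
    (Summable Ψ →
      volume {ξ : ℝ | {α : ℝ | ∃ P : Polynomial ℤ, IsMinIntPoly α P ∧
        P.natDegree = n ∧
        |ξ - α| < (intPolyHeight P : ℝ) ^ (-(n : ℤ)) * Ψ (intPolyHeight P)}.Infinite} = 0) := by
  refine ⟨fun hΨ => ?_, volume_infinite_eq_zero_of_summable n hpos hmono⟩
  have hall := ae_all_iff.2 fun X : ℕ => ae_infinite_of_not_summable hn hpos hmono hΨ X
  refine ae_iff.1 (hall.mono fun ξ hξ => ?_)
  obtain ⟨X, hX⟩ := exists_nat_gt |ξ|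
  exact hξ X hX
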